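/- There exists a bounded linear operator T on the real Banach space ℓ¹ such that: (1) T is quasinilpotent (spectral radius 0); (2) T has no nontrivial closed invariant subspace; and (3) the modulus |T| of T — the bounded operator on ℓ¹ whose matrix entries are |t_{ij}|, where t_{ij} = (T f_j)_i — satisfies r(|T|) > 0 and has a positive eigenvector for the eigenvalue r(|T|): there is x ∈ ℓ¹ with x_i ≥ 0 for all i, x ≠ 0, and |T| x = r(|T|) x. In particular, |T| has a nontrivial closed invariant subspace even though T has none. -/

import Mathlib

open Filter Topology

/-- The real sequence space `ℓ¹`. -/
abbrev L1 : Type := lp (fun _ : ℕ => ℝ) 1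

namespace L1

/-- The `j`-th standard unit vector. -/
noncomputable abbrev unit (j : ℕ) : L1 := lp.single 1 j (1 : ℝ)

lemma unit_apply (j i : ℕ) : unit j i = if i = j then 1 else 0 := by
  simp [unit, lp.single_apply, Pi.single_apply]

lemma norm_unit (j : ℕ) : ‖unit j‖ = 1 := by
  simp [unit, lp.norm_single]

lemma hasSum_norm (x : L1) : HasSum (fun j => |x j|) ‖x‖ := by
  have h := lp.hasSum_norm (E := fun _ : ℕ => ℝ) (p := 1) (by simp) x
  simpa using h

lemma hasSum_unit (x : L1) : HasSum (fun j => x j • unit j) x := by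
  have h := lp.hasSum_single (E := fun _ : ℕ => ℝ) (p := 1) (by simp) x
  convert h using 2 with j
  ext i
  simp [unit, lp.single_apply, Pi.single_apply]

lemma abs_apply_le (x : L1) (i : ℕ) : |x i| ≤ ‖x‖ := by
  simpa using lp.norm_apply_le_norm (E := fun _ : ℕ => ℝ) (p := 1) (by simp) x i

/-- The continuous evaluation at a coordinate. -/
noncomputable def coord (i : ℕ) : L1 →L[ℝ] ℝ :=
  LinearMap.mkContinuous
    { toFun := fun x => x i, map_add' := fun _ _ => rfl, map_smul' := fun _ _ => rfl } 1
    (fun x => by rw [one_mul]; exact abs_apply_le x i)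

@[simp] lemma coord_apply (i : ℕ) (x : L1) : coord i x = x i := rfl

section Columns

variable {F : Type*} [NormedAddCommGroup F] [NormedSpace ℝ F]

lemma hasSum_map (U : L1 →L[ℝ] F) (x : L1) : HasSum (fun j => x j • U (unit j)) (U x) := by
  simpa using (hasSum_unit x).mapL U

lemma norm_apply_le_of_hasSum {U : L1 →L[ℝ] F} {x : L1} {v : ℕ → ℝ}
    (hv : ∀ j, ‖U (unit j)‖ ≤ v j) {S : ℝ} (hS : HasSum (fun j => |x j| * v j) S) :
    ‖U x‖ ≤ S := by
  rw [← (hasSum_map U x).tsum_eq]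
  refine tsum_of_norm_bounded hS fun j => ?_
  rw [norm_smul, Real.norm_eq_abs]
  exact mul_le_mul_of_nonneg_left (hv j) (abs_nonneg _)

lemma opNorm_le {U : L1 →L[ℝ] F} {C : ℝ} (hC : 0 ≤ C) (h : ∀ j, ‖U (unit j)‖ ≤ C) :
    ‖U‖ ≤ C := by
  refine U.opNorm_le_bound hC fun x => ?_
  rw [mul_comm]
  exact norm_apply_le_of_hasSum h ((hasSum_norm x).mul_right C)

lemma norm_map_unit_le (U : L1 →L[ℝ] F) (j : ℕ) : ‖U (unit j)‖ ≤ ‖U‖ := by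
  simpa [norm_unit] using U.le_opNorm (unit j)

lemma ext_unit {U V : L1 →L[ℝ] F} (h : ∀ j, U (unit j) = V (unit j)) : U = V := by
  ext x
  exact (hasSum_map U x).unique (by simpa [h] using hasSum_map V x)

variable [CompleteSpace F]

lemma summable_cols {u : ℕ → F} {C : ℝ} (h : ∀ j, ‖u j‖ ≤ C) (x : L1) :
    Summable (fun j => x j • u j) := by
  refine Summable.of_norm_bounded ((hasSum_norm x).summable.mul_right C) fun j => ?_
  rw [norm_smul, Real.norm_eq_abs]
  exact mul_le_mul_of_nonneg_left (h j) (abs_nonneg _)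

/-- The bounded operator on `ℓ¹` with prescribed uniformly bounded columns. -/
noncomputable def ofCols (u : ℕ → F) (C : ℝ) (h : ∀ j, ‖u j‖ ≤ C) : L1 →L[ℝ] F :=
  LinearMap.mkContinuous
    { toFun := fun x => ∑' j, x j • u j
      map_add' := fun x y => by
        rw [← (summable_cols h x).tsum_add (summable_cols h y)]
        simp [add_smul]
      map_smul' := fun c x => by
        simp [mul_smul, (summable_cols h x).tsum_const_smul] } C
    (fun x => by
      rw [mul_comm]
      refine tsum_of_norm_bounded ((hasSum_norm x).mul_right C) fun j => ?_
      rw [norm_smul, Real.norm_eq_abs]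
      exact mul_le_mul_of_nonneg_left (h j) (abs_nonneg _))

lemma ofCols_unit (u : ℕ → F) (C : ℝ) (h : ∀ j, ‖u j‖ ≤ C) (j : ℕ) :
    ofCols u C h (unit j) = u j := by
  change ∑' k, unit j k • u k = u j
  rw [tsum_eq_single j]
  · simp
  · intro k hk
    simp [hk]

lemma exists_cols (u : ℕ → F) (C : ℝ) (h : ∀ j, ‖u j‖ ≤ C) :
    ∃ U : L1 →L[ℝ] F, ∀ j, U (unit j) = u j :=
  ⟨ofCols u C h, ofCols_unit u C h⟩

end Columns

lemma submodule_eq_top {J : Submodule ℝ L1} (hJ : IsClosed (J : Set L1))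
    (h : ∀ j, unit j ∈ J) : J = ⊤ := by
  rw [eq_top_iff]
  intro x _
  exact hJ.mem_of_tendsto (hasSum_unit x)
    (Eventually.of_forall fun s => J.sum_mem fun j _ => J.smul_mem _ (h j))

end L1

namespace Read

/-- The level whose working block is copied in block `l`; every square is attained at
arbitrarily large arguments. -/
def src (l : ℕ) : ℕ := (Nat.sqrt l - (l - Nat.sqrt l ^ 2)) ^ 2

lemma src_le (l : ℕ) : src l ≤ l := by
  unfold src
  calc (Nat.sqrt l - (l - Nat.sqrt l ^ 2)) ^ 2 ≤ (Nat.sqrt l) ^ 2 :=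
        Nat.pow_le_pow_left (Nat.sub_le _ _) 2
    _ ≤ l := Nat.sqrt_le' l

/-- The last position of the blocks preceding block `l`. -/
def bnd : ℕ → ℕ
  | 0 => 0
  | l + 1 => 2 * bnd l + 2 + bnd (src l)
decreasing_by
  · omega
  · exact Nat.lt_succ_of_le (src_le l)

/-- The first working position of block `l`. -/
def mid (l : ℕ) : ℕ := 2 * bnd l + 2

lemma bnd_zero : bnd 0 = 0 := by rw [bnd]

lemma bnd_succ (l : ℕ) : bnd (l + 1) = mid l + bnd (src l) := by rw [bnd, mid]

lemma bnd_lt_mid (l : ℕ) : bnd l < mid l := by unfold mid; omega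

lemma mid_le (l : ℕ) : mid l ≤ bnd (l + 1) := by rw [bnd_succ]; omega

lemma bnd_strictMono : StrictMono bnd :=
  strictMono_nat_of_lt_succ fun l => (bnd_lt_mid l).trans_le (mid_le l)

lemma le_bnd (l : ℕ) : l ≤ bnd l := bnd_strictMono.le_apply

lemma bnd_src_le (l : ℕ) : bnd (src l) ≤ bnd l := bnd_strictMono.monotone (src_le l)

lemma exists_le_bnd (j : ℕ) : ∃ l, j ≤ bnd (l + 1) :=
  ⟨j, (Nat.le_succ j).trans (le_bnd (j + 1))⟩

/-- The block containing the position `j`. -/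
def blk (j : ℕ) : ℕ := Nat.find (exists_le_bnd j)

lemma le_bnd_blk (j : ℕ) : j ≤ bnd (blk j + 1) := Nat.find_spec (exists_le_bnd j)

lemma blk_le {j l : ℕ} (h : j ≤ bnd (l + 1)) : blk j ≤ l := Nat.find_min' _ h

lemma blk_eq {j l : ℕ} (h₁ : bnd l < j) (h₂ : j ≤ bnd (l + 1)) : blk j = l := by
  refine le_antisymm (blk_le h₂) ?_
  by_contra! h
  have := bnd_strictMono.monotone (show blk j + 1 ≤ l from h)
  have := le_bnd_blk j
  omega

lemma bnd_blk_lt {j : ℕ} (h : j ≠ 0) : bnd (blk j) < j := by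
  rcases Nat.eq_zero_or_pos (blk j) with h0 | h0
  · rw [h0, bnd_zero]; omega
  · by_contra! hj
    have : blk j ≤ blk j - 1 := blk_le (by rwa [Nat.sub_add_cancel h0])
    omega

/-- Positions at which a previous block is copied. -/
def Working (j : ℕ) : Prop := mid (blk j) ≤ j

instance : DecidablePred Working := fun _ => Nat.decLe _ _

lemma working_iff {j : ℕ} :
    Working j ↔ ∃ l p, p ≤ bnd (src l) ∧ j = mid l + p := by
  constructor
  · intro h
    refine ⟨blk j, j - mid (blk j), ?_, (Nat.add_sub_of_le h).symm⟩
    have := le_bnd_blk j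
    rw [bnd_succ] at this
    omega
  · rintro ⟨l, p, hp, rfl⟩
    have : blk (mid l + p) = l :=
      blk_eq (lt_of_lt_of_le (bnd_lt_mid l) (Nat.le_add_right _ _)) (by rw [bnd_succ]; omega)
    unfold Working
    rw [this]
    omega

lemma blk_mid {l p : ℕ} (hp : p ≤ bnd (src l)) : blk (mid l + p) = l :=
  blk_eq (lt_of_lt_of_le (bnd_lt_mid l) (Nat.le_add_right _ _)) (by rw [bnd_succ]; omega)

lemma working_mid {l p : ℕ} (hp : p ≤ bnd (src l)) : Working (mid l + p) :=
  working_iff.2 ⟨l, p, hp, rfl⟩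

lemma not_working_zero : ¬ Working 0 := by
  unfold Working mid; omega

/-- Case analysis on a position: it is a working position or a layoff position. -/
lemma cases_pos (j : ℕ) :
    (∃ l p, p ≤ bnd (src l) ∧ j = mid l + p) ∨ ¬ Working j := by
  by_cases h : Working j
  · exact Or.inl (working_iff.1 h)
  · exact Or.inr h

lemma src_sq_add {n m : ℕ} (h : m ≤ n) : src (n ^ 2 + (n - m)) = m ^ 2 := by
  have hs : Nat.sqrt (n ^ 2 + (n - m)) = n :=
    Nat.sqrt_add_eq' n (by omega)
  unfold src
  rw [hs, Nat.add_sub_cancel_left, Nat.sub_sub_self h]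

end Read

namespace Read

open L1

/-- The growth conditions on the parameter sequence used for norm estimates. -/
structure Params (r : ℕ → ℝ) : Prop where
  two_pow_le : ∀ i, 2 ^ (i + 1) ≤ r i
  mono : Monotone r

section Weights

variable (r : ℕ → ℝ)

/-- The small weight attached to the layoff positions of block `l`. -/
noncomputable def eta (l : ℕ) : ℝ := ((r l)⁻¹) ^ (bnd l + 3)

/-- The weights of the shift. -/
noncomputable def wt (j : ℕ) : ℝ :=
  if j < mid (blk (j + 1)) then eta r (blk (j + 1)) else wt (j - mid (blk (j + 1)))
termination_by j
decreasing_by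
  have : 0 < mid (blk (j + 1)) := by unfold mid; omega
  omega

lemma wt_layoff {l j : ℕ} (h₁ : bnd l ≤ j) (h₂ : j < mid l) : wt r j = eta r l := by
  have hb : blk (j + 1) = l := blk_eq (by omega) ((show j + 1 ≤ mid l from h₂).trans (mid_le l))
  rw [wt, hb, if_pos h₂]

lemma wt_bnd (l : ℕ) : wt r (bnd l) = eta r l := wt_layoff r le_rfl (bnd_lt_mid l)

lemma wt_copy {l p : ℕ} (hp : p < bnd (src l)) : wt r (mid l + p) = wt r p := by
  have hb : blk (mid l + p + 1) = l := blk_mid (p := p + 1) hp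
  rw [wt, hb, if_neg (by omega), Nat.add_sub_cancel_left]

lemma cases_wt (j : ℕ) :
    (∃ l, bnd l ≤ j ∧ j < mid l) ∨ ∃ l p, p < bnd (src l) ∧ j = mid l + p := by
  have h1 : bnd (blk (j + 1)) < j + 1 := bnd_blk_lt (Nat.succ_ne_zero j)
  have h2 := le_bnd_blk (j + 1)
  rw [bnd_succ] at h2
  by_cases h : j < mid (blk (j + 1))
  · exact Or.inl ⟨_, by omega, h⟩
  · exact Or.inr ⟨blk (j + 1), j - mid (blk (j + 1)), by omega, by omega⟩

/-- The scaling of the unit vector at position `j`. -/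
noncomputable def amp (j : ℕ) : ℝ :=
  if Working j then r (src (blk j)) ^ (j - mid (blk j) + 1) else 1

/-- The orbit basis. -/
noncomputable def vec (j : ℕ) : L1 :=
  if Working j then (amp r j)⁻¹ • unit j + vec (j - mid (blk j)) else unit j
termination_by j
decreasing_by
  have : 0 < mid (blk j) := by unfold mid; omega
  have : mid (blk j) ≤ j := by assumption
  omega

lemma amp_mid {l p : ℕ} (hp : p ≤ bnd (src l)) :
    amp r (mid l + p) = r (src l) ^ (p + 1) := by
  rw [amp, if_pos (working_mid hp), blk_mid hp, Nat.add_sub_cancel_left]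

lemma vec_mid {l p : ℕ} (hp : p ≤ bnd (src l)) :
    vec r (mid l + p) = (r (src l) ^ (p + 1))⁻¹ • unit (mid l + p) + vec r p := by
  rw [vec, if_pos (working_mid hp), amp_mid r hp, blk_mid hp, Nat.add_sub_cancel_left]

lemma vec_layoff {j : ℕ} (h : ¬ Working j) : vec r j = unit j := by
  rw [vec, if_neg h]

lemma vec_zero : vec r 0 = unit 0 := vec_layoff r not_working_zero

/-- The products of consecutive weights. -/
noncomputable def prd (j h : ℕ) : ℝ := ∏ q ∈ Finset.range h, wt r (j + q)

lemma prd_zero (j : ℕ) : prd r j 0 = 1 := by simp [prd]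

lemma prd_succ (j h : ℕ) : prd r j (h + 1) = prd r j h * wt r (j + h) := by
  rw [prd, Finset.prod_range_succ, prd]

lemma prd_add (j h k : ℕ) : prd r j (h + k) = prd r j h * prd r (j + h) k := by
  simp [prd, Finset.prod_range_add, add_assoc]

/-- The columns of the operator. -/
noncomputable def col (j : ℕ) : L1 :=
  if Working j then
    amp r j • (wt r j • vec r (j + 1) - wt r (j - mid (blk j)) • vec r (j - mid (blk j) + 1))
  else wt r j • vec r (j + 1)

lemma col_layoff {j : ℕ} (h : ¬ Working j) : col r j = wt r j • vec r (j + 1) := if_neg h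

lemma col_mid {l p : ℕ} (hp : p ≤ bnd (src l)) :
    col r (mid l + p) = r (src l) ^ (p + 1) •
      (wt r (mid l + p) • vec r (mid l + p + 1) - wt r p • vec r (p + 1)) := by
  rw [col, if_pos (working_mid hp), amp_mid r hp, blk_mid hp, Nat.add_sub_cancel_left]

lemma col_end (l : ℕ) :
    col r (mid l + bnd (src l)) =
      (r (src l) ^ (bnd (src l) + 1) * eta r (l + 1)) • vec r (bnd (l + 1) + 1) -
      (r (src l) ^ (bnd (src l) + 1) * eta r (src l)) • vec r (bnd (src l) + 1) := by
  rw [col_mid r le_rfl, ← bnd_succ, wt_bnd, wt_bnd, smul_sub, smul_smul, smul_smul]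

end Weights

namespace Params

variable {r : ℕ → ℝ} (hr : Params r)
include hr

lemma two_le (i : ℕ) : 2 ≤ r i := by
  refine le_trans ?_ (hr.two_pow_le i)
  rw [pow_succ]
  nlinarith [one_le_pow₀ (M₀ := ℝ) (n := i) one_le_two]

lemma pos (i : ℕ) : 0 < r i := by linarith [hr.two_le i]

lemma one_le (i : ℕ) : 1 ≤ r i := by linarith [hr.two_le i]

lemma inv_le (i : ℕ) : (r i)⁻¹ ≤ (1 / 2) ^ (i + 1) := by
  rw [one_div, inv_pow]
  exact inv_anti₀ (by positivity) (hr.two_pow_le i)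

lemma inv_le_one (i : ℕ) : (r i)⁻¹ ≤ 1 := inv_le_one_of_one_le₀ (hr.one_le i)

lemma inv_nonneg (i : ℕ) : 0 ≤ (r i)⁻¹ := (inv_pos.2 (hr.pos i)).le

lemma eta_pos (l : ℕ) : 0 < eta r l := pow_pos (inv_pos.2 (hr.pos l)) _

lemma eta_le_inv (l : ℕ) : eta r l ≤ (r l)⁻¹ := by
  simpa [eta] using pow_le_pow_of_le_one (hr.inv_nonneg l) (hr.inv_le_one l)
    (show 1 ≤ bnd l + 3 by omega)

lemma eta_le_one (l : ℕ) : eta r l ≤ 1 := (hr.eta_le_inv l).trans (hr.inv_le_one l)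

lemma inv_anti {i j : ℕ} (h : i ≤ j) : (r j)⁻¹ ≤ (r i)⁻¹ := inv_anti₀ (hr.pos i) (hr.mono h)

lemma eta_anti {i j : ℕ} (h : i ≤ j) : eta r j ≤ eta r i := by
  unfold eta
  calc ((r j)⁻¹) ^ (bnd j + 3) ≤ ((r j)⁻¹) ^ (bnd i + 3) :=
        pow_le_pow_of_le_one (hr.inv_nonneg j) (hr.inv_le_one j)
          (by have := bnd_strictMono.monotone h; omega)
    _ ≤ _ := pow_le_pow_left₀ (hr.inv_nonneg j) (hr.inv_anti h) _

lemma wt_pos_le (j : ℕ) : 0 < wt r j ∧ wt r j ≤ 1 := by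
  induction j using Nat.strong_induction_on with
  | _ j ih =>
    rcases cases_wt j with ⟨l, h1, h2⟩ | ⟨l, p, hp, rfl⟩
    · rw [wt_layoff r h1 h2]
      exact ⟨hr.eta_pos l, hr.eta_le_one l⟩
    · rw [wt_copy r hp]
      exact ih p (by unfold mid; omega)

lemma wt_pos (j : ℕ) : 0 < wt r j := (hr.wt_pos_le j).1

lemma wt_le_one (j : ℕ) : wt r j ≤ 1 := (hr.wt_pos_le j).2

lemma prd_pos (j h : ℕ) : 0 < prd r j h := Finset.prod_pos fun _ _ => hr.wt_pos _

lemma prd_le_one (j h : ℕ) : prd r j h ≤ 1 :=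
  Finset.prod_le_one (fun _ _ => (hr.wt_pos _).le) fun _ _ => hr.wt_le_one _

/-- A window containing `q` has product at most the weight at `q`. -/
lemma prd_le_wt {j h q : ℕ} (h₁ : j ≤ q) (h₂ : q < j + h) : prd r j h ≤ wt r q := by
  obtain ⟨c, rfl⟩ := Nat.exists_eq_add_of_le h₁
  obtain ⟨d, rfl⟩ := Nat.exists_eq_add_of_le (show c + 1 ≤ h by omega)
  rw [prd_add, prd_succ]
  have h1 := hr.prd_le_one j c
  have h2 := hr.prd_le_one (j + (c + 1)) d
  have h3 := hr.wt_pos (j + c)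
  have h4 := hr.prd_pos j c
  calc _ ≤ prd r j c * wt r (j + c) * 1 := by gcongr
    _ ≤ 1 * wt r (j + c) * 1 := by gcongr
    _ = _ := by ring

lemma norm_vec_le {i : ℕ} : ∀ {j : ℕ}, j ≤ bnd i → ‖vec r j‖ ≤ 2 - (1 / 2) ^ i := by
  intro j
  induction j using Nat.strong_induction_on generalizing i with
  | _ j ih =>
    intro hj
    rcases cases_pos j with ⟨l, p, hp, rfl⟩ | h
    · have hli : l < i := bnd_strictMono.lt_iff_lt.1
        ((bnd_lt_mid l).trans_le (le_trans (Nat.le_add_right _ _) hj))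
      have h1 := ih p (by unfold mid; omega) hp
      rw [vec_mid r hp]
      refine (norm_add_le _ _).trans ?_
      rw [norm_smul, norm_unit, mul_one, norm_inv, norm_pow, Real.norm_eq_abs,
        abs_of_pos (hr.pos _), ← inv_pow]
      have h2 : ((r (src l))⁻¹) ^ (p + 1) ≤ (r (src l))⁻¹ := by
        simpa using pow_le_pow_of_le_one (hr.inv_nonneg (src l)) (hr.inv_le_one (src l))
          (show 1 ≤ p + 1 by omega)
      have h3 := hr.inv_le (src l)
      have h4 : ((1 : ℝ) / 2) ^ i ≤ (1 / 2) ^ (src l + 1) :=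
        pow_le_pow_of_le_one (by norm_num) (by norm_num) (by have := src_le l; omega)
      rw [pow_succ] at h3 h4
      linarith
    · rw [vec_layoff r h, norm_unit]
      have : ((1 : ℝ) / 2) ^ i ≤ 1 := pow_le_one₀ (by norm_num) (by norm_num)
      linarith

lemma norm_vec_le_two (j : ℕ) : ‖vec r j‖ ≤ 2 := by
  refine (hr.norm_vec_le (le_bnd j)).trans ?_
  have : (0 : ℝ) ≤ (1 / 2) ^ j := by positivity
  linarith

lemma amp_ge_one (j : ℕ) : 1 ≤ amp r j := by
  unfold amp
  split_ifs
  · exact one_le_pow₀ (hr.one_le _)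
  · exact le_rfl

/-- The key balance between scalings and small weights. -/
lemma pow_mul_eta_le {s p l : ℕ} (hp : p ≤ bnd s) (hl : s ≤ l) :
    r s ^ (p + 1) * eta r l ≤ ((r s)⁻¹) ^ 2 := by
  have hs := hr.pos s
  calc r s ^ (p + 1) * eta r l ≤ r s ^ (bnd s + 1) * eta r s :=
        mul_le_mul (pow_le_pow_right₀ (hr.one_le s) (by omega)) (hr.eta_anti hl)
          (hr.eta_pos l).le (by positivity)
    _ = _ := by
      unfold eta
      rw [show bnd s + 3 = (bnd s + 1) + 2 by omega, pow_add (r s)⁻¹, ← mul_assoc, inv_pow, inv_pow,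
        mul_inv_cancel₀ (by positivity), one_mul]

lemma inv_sq_le (s : ℕ) : ((r s)⁻¹) ^ 2 ≤ 1 / 4 := by
  have h : (r s)⁻¹ ≤ 1 / 2 := by
    rw [one_div]; exact inv_anti₀ (by norm_num) (hr.two_le s)
  nlinarith [hr.inv_nonneg s]

lemma col_inner {l p : ℕ} (hp : p < bnd (src l)) :
    col r (mid l + p) = (wt r p * (r (src l))⁻¹) • unit (mid l + p + 1) := by
  have hs := (hr.pos (src l)).ne'
  rw [col_mid r hp.le, wt_copy r hp, add_assoc, vec_mid r (show p + 1 ≤ _ from hp), smul_add,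
    add_sub_cancel_right, smul_smul, smul_smul]
  congr 1
  rw [pow_succ _ (p + 1)]
  field_simp

lemma norm_col_end_le (l : ℕ) :
    ‖col r (mid l + bnd (src l))‖ ≤ 4 * ((r (src l))⁻¹) ^ 2 := by
  rw [col_end]
  have h1 := hr.pow_mul_eta_le (le_refl (bnd (src l))) (le_refl (src l))
  have h2 := hr.pow_mul_eta_le (le_refl (bnd (src l))) ((src_le l).trans (Nat.le_succ l))
  have hp : 0 < r (src l) ^ (bnd (src l) + 1) := pow_pos (hr.pos _) _
  refine (norm_sub_le _ _).trans ?_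
  rw [norm_smul, norm_smul, Real.norm_eq_abs, Real.norm_eq_abs,
    abs_of_pos (mul_pos hp (hr.eta_pos _)), abs_of_pos (mul_pos hp (hr.eta_pos _))]
  have h3 := hr.norm_vec_le_two (bnd (l + 1) + 1)
  have h4 := hr.norm_vec_le_two (bnd (src l) + 1)
  have h5 : 0 ≤ ((r (src l))⁻¹) ^ 2 := by positivity
  have := mul_le_mul h2 h3 (norm_nonneg _) h5
  have := mul_le_mul h1 h4 (norm_nonneg _) h5
  linarith

lemma norm_col_layoff_le {j : ℕ} (h : ¬ Working j) : ‖col r j‖ ≤ 2 * wt r j := by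
  rw [col_layoff r h, norm_smul, Real.norm_eq_abs, abs_of_pos (hr.wt_pos j), mul_comm]
  exact mul_le_mul_of_nonneg_right (hr.norm_vec_le_two _) (hr.wt_pos j).le

lemma norm_col_inner {l p : ℕ} (hp : p < bnd (src l)) :
    ‖col r (mid l + p)‖ = wt r p * (r (src l))⁻¹ := by
  rw [hr.col_inner hp, norm_smul, norm_unit, mul_one, Real.norm_eq_abs,
    abs_of_nonneg (mul_nonneg (hr.wt_pos p).le (hr.inv_nonneg _))]

lemma norm_col_le (j : ℕ) : ‖col r j‖ ≤ 2 := by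
  rcases cases_pos j with ⟨l, p, hp, rfl⟩ | h
  · rcases hp.lt_or_eq with hp | rfl
    · rw [hr.norm_col_inner hp]
      have := mul_le_mul (hr.wt_le_one p) (hr.inv_le_one (src l)) (hr.inv_nonneg _) zero_le_one
      linarith
    · have := hr.norm_col_end_le l
      have := hr.inv_sq_le (src l)
      linarith
  · have := hr.norm_col_layoff_le h
    have := hr.wt_le_one j
    linarith

section Operator

variable {T : L1 →L[ℝ] L1} (hT : ∀ j, T (unit j) = col r j)
include hT

lemma map_vec (j : ℕ) : T (vec r j) = wt r j • vec r (j + 1) := by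
  induction j using Nat.strong_induction_on with
  | _ j ih =>
    rcases cases_pos j with ⟨l, p, hp, rfl⟩ | h
    · have h0 : r (src l) ^ (p + 1) ≠ 0 := pow_ne_zero _ (hr.pos _).ne'
      rw [vec_mid r hp, map_add, map_smul, hT, col_mid r hp, ih p (by unfold mid; omega),
        smul_smul, inv_mul_cancel₀ h0, one_smul, sub_add_cancel]
    · rw [vec_layoff r h, hT, col_layoff r h]

lemma pow_map_vec (h j : ℕ) : (T ^ h) (vec r j) = prd r j h • vec r (j + h) := by
  induction h with
  | zero => simp [prd_zero]
  | succ h ih =>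
    rw [pow_succ', mul_apply_eq_comp, ih, map_smul, hr.map_vec hT, smul_smul,
      prd_succ, add_assoc]

lemma norm_pow_map_vec_le (h j : ℕ) : ‖(T ^ h) (vec r j)‖ ≤ 2 * prd r j h := by
  rw [hr.pow_map_vec hT, norm_smul, Real.norm_eq_abs, abs_of_pos (hr.prd_pos _ _), mul_comm]
  exact mul_le_mul_of_nonneg_right (hr.norm_vec_le_two _) (hr.prd_pos _ _).le

lemma cyclic {J : Submodule ℝ L1} (hJ : IsClosed (J : Set L1)) (hinv : ∀ x ∈ J, T x ∈ J)
    (h0 : unit 0 ∈ J) : J = ⊤ := by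
  have hv : ∀ j, vec r j ∈ J := by
    intro j
    induction j with
    | zero => rwa [vec_zero]
    | succ j ih =>
      have h := hinv _ ih
      rwa [hr.map_vec hT, J.smul_mem_iff (hr.wt_pos j).ne'] at h
  refine submodule_eq_top hJ fun j => ?_
  rcases cases_pos j with ⟨l, p, hp, rfl⟩ | h
  · have h := J.sub_mem (hv (mid l + p)) (hv p)
    rwa [vec_mid r hp, add_sub_cancel_right,
      J.smul_mem_iff (inv_ne_zero (pow_ne_zero _ (hr.pos _).ne'))] at h
  · rw [← vec_layoff r h]; exact hv j

end Operator

end Params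

end Read

lemma tendsto_root_zero {a : ℕ → ℝ} (ha : ∀ n, 0 ≤ a n)
    (h : ∀ ε : ℝ, 0 < ε → ε < 1 → ∃ D : ℝ, 0 < D ∧ ∀ n, a n ≤ D * ε ^ n) :
    Tendsto (fun n : ℕ => a n ^ (1 / (n : ℝ))) atTop (nhds 0) := by
  rw [Metric.tendsto_nhds]
  intro e he
  obtain ⟨D, hD, hle⟩ := h (min (e / 2) (1 / 2)) (by positivity)
    ((min_le_right _ _).trans_lt (by norm_num))
  have hlim : Tendsto (fun n : ℕ => D ^ (1 / (n : ℝ))) atTop (nhds 1) := by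
    have h0 : Tendsto (fun n : ℕ => 1 / (n : ℝ)) atTop (nhds 0) :=
      tendsto_one_div_atTop_nhds_zero_nat
    simpa [Function.comp_def] using (Real.continuousAt_const_rpow (b := 0) hD.ne').tendsto.comp h0
  filter_upwards [hlim.eventually_lt_const (show (1 : ℝ) < 2 by norm_num),
    eventually_gt_atTop 0] with n hn hn0
  have hn0' : (n : ℝ) ≠ 0 := by positivity
  have hmin : 0 < min (e / 2) (1 / 2) := by positivity
  rw [Real.dist_eq, sub_zero, abs_of_nonneg (Real.rpow_nonneg (ha n) _)]
  calc a n ^ (1 / (n : ℝ)) ≤ (D * min (e / 2) (1 / 2) ^ n) ^ (1 / (n : ℝ)) :=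
        Real.rpow_le_rpow (ha n) (hle n) (by positivity)
    _ = D ^ (1 / (n : ℝ)) * min (e / 2) (1 / 2) := by
        rw [Real.mul_rpow hD.le (by positivity), ← Real.rpow_natCast, ← Real.rpow_mul hmin.le,
          mul_one_div_cancel hn0', Real.rpow_one]
    _ < 2 * min (e / 2) (1 / 2) := by gcongr
    _ ≤ e := by linarith [min_le_left (e / 2) (1 / 2)]

namespace Read

open L1

namespace Params

variable {r : ℕ → ℝ} (hr : Params r)
include hr

lemma exists_wt_le (i j : ℕ) : ∃ q, j ≤ q ∧ q ≤ j + bnd i ∧ wt r q ≤ eta r i := by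
  induction j using Nat.strong_induction_on with
  | _ j ih =>
    rcases le_or_gt j (bnd i) with hj | hj
    · exact ⟨bnd i, hj, by omega, (wt_bnd r i).le⟩
    rcases cases_wt j with ⟨l, h1, h2⟩ | ⟨l, p, hp, rfl⟩
    · have hil : i < l + 1 :=
        bnd_strictMono.lt_iff_lt.1 (hj.trans (h2.trans_le (mid_le l)))
      exact ⟨j, le_rfl, by omega, by
        rw [wt_layoff r h1 h2]; exact hr.eta_anti (Nat.lt_succ_iff.1 hil)⟩
    · have hil : i < l + 1 :=
        bnd_strictMono.lt_iff_lt.1 (hj.trans (by rw [bnd_succ]; omega))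
      obtain ⟨q, hq1, hq2, hq3⟩ := ih p (by unfold mid; omega)
      rcases lt_or_ge q (bnd (src l)) with hq | hq
      · exact ⟨mid l + q, by omega, by omega, by rwa [wt_copy r hq]⟩
      · exact ⟨bnd (l + 1), by rw [bnd_succ]; omega, by rw [bnd_succ]; omega, by
          rw [wt_bnd]; exact hr.eta_anti hil.le⟩

lemma exists_inv_le {ε : ℝ} (hε : 0 < ε) : ∃ i, (r i)⁻¹ ≤ ε := by
  obtain ⟨i, hi⟩ := exists_pow_lt_of_lt_one hε (show (1 / 2 : ℝ) < 1 by norm_num)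
  refine ⟨i, (hr.inv_le i).trans (le_trans ?_ hi.le)⟩
  exact pow_le_pow_of_le_one (by norm_num) (by norm_num) (Nat.le_succ i)

lemma exists_prd_le {ε : ℝ} (hε : 0 < ε) (hε1 : ε < 1) :
    ∃ C : ℝ, 0 < C ∧ ∀ j h, prd r j h ≤ C * ε ^ h := by
  obtain ⟨i, hi⟩ := hr.exists_inv_le hε
  have hL : ∀ j, prd r j (bnd i + 1) ≤ ε ^ (bnd i + 1) := by
    intro j
    obtain ⟨q, h1, h2, h3⟩ := hr.exists_wt_le i j
    refine (hr.prd_le_wt h1 (by omega)).trans (h3.trans ?_)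
    unfold eta
    exact (pow_le_pow_left₀ (hr.inv_nonneg i) hi _).trans
      (pow_le_pow_of_le_one hε.le hε1.le (by omega))
  have key : ∀ h j, prd r j h * ε ^ (bnd i + 1) ≤ ε ^ h := by
    intro h
    induction h using Nat.strong_induction_on with
    | _ h ih =>
      intro j
      rcases lt_or_ge h (bnd i + 1) with hh | hh
      · calc prd r j h * ε ^ (bnd i + 1) ≤ 1 * ε ^ h :=
            mul_le_mul (hr.prd_le_one j h) (pow_le_pow_of_le_one hε.le hε1.le hh.le)
              (by positivity) zero_le_one
          _ = _ := one_mul _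
      · obtain ⟨k, rfl⟩ := Nat.exists_eq_add_of_le hh
        rw [prd_add, pow_add ε _ k, mul_assoc]
        exact mul_le_mul (hL j) (ih k (by omega) _)
          (mul_nonneg (hr.prd_pos _ _).le (by positivity)) (by positivity)
  refine ⟨(ε ^ (bnd i + 1))⁻¹, by positivity, fun j h => ?_⟩
  rw [inv_mul_eq_div, le_div_iff₀ (by positivity)]
  exact key h j

lemma prd_mul_le {ε C : ℝ} (hε : 0 < ε) (hC : ∀ j h, prd r j h ≤ C * ε ^ h)
    {j h q : ℕ} (h₁ : j ≤ q) (h₂ : q < j + h) :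
    prd r j h * ε ≤ C ^ 2 * ε ^ h * wt r q := by
  obtain ⟨c, rfl⟩ := Nat.exists_eq_add_of_le h₁
  obtain ⟨d, rfl⟩ := Nat.exists_eq_add_of_le (show c + 1 ≤ h by omega)
  have h1 := mul_le_mul (hC j c) (hC (j + (c + 1)) d) (hr.prd_pos _ _).le
    ((hr.prd_pos _ _).le.trans (hC j c))
  rw [prd_add, prd_succ]
  calc _ = (prd r j c * prd r (j + (c + 1)) d) * (wt r (j + c) * ε) := by ring
    _ ≤ (C * ε ^ c * (C * ε ^ d)) * (wt r (j + c) * ε) :=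
        mul_le_mul_of_nonneg_right h1 (mul_nonneg (hr.wt_pos _).le hε.le)
    _ = _ := by ring

section Operator

variable {T : L1 →L[ℝ] L1} (hT : ∀ j, T (unit j) = col r j)
include hT

/-- The orbit of a unit vector inside a copied region. -/
lemma pow_map_unit_inner {l p : ℕ} : ∀ {h : ℕ}, p + h ≤ bnd (src l) →
    (T ^ h) (unit (mid l + p)) =
      (prd r p h * ((r (src l))⁻¹) ^ h) • unit (mid l + (p + h)) := by
  intro h
  induction h with
  | zero => simp [prd_zero]
  | succ h ih =>
    intro hp
    rw [pow_succ', mul_apply_eq_comp, ih (by omega), map_smul, hT,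
      hr.col_inner (show p + h < _ by omega), smul_smul, prd_succ]
    congr 1
    ring

/-- The orbit of a working unit vector in terms of the orbit basis. -/
lemma pow_map_unit_working {l p h : ℕ} (hp : p ≤ bnd (src l)) :
    (T ^ h) (unit (mid l + p)) = r (src l) ^ (p + 1) •
      (prd r (mid l + p) h • vec r (mid l + p + h) - prd r p h • vec r (p + h)) := by
  have h0 : r (src l) ^ (p + 1) ≠ 0 := pow_ne_zero _ (hr.pos _).ne'
  have : unit (mid l + p) = r (src l) ^ (p + 1) • (vec r (mid l + p) - vec r p) := by
    rw [vec_mid r hp, add_sub_cancel_right, smul_smul, mul_inv_cancel₀ h0, one_smul]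
  rw [this, map_smul, map_sub, hr.pow_map_vec hT, hr.pow_map_vec hT]

lemma norm_pow_map_unit_working {l p h : ℕ} (hp : p ≤ bnd (src l)) :
    ‖(T ^ h) (unit (mid l + p))‖ ≤
      r (src l) ^ (p + 1) * (2 * prd r (mid l + p) h + 2 * prd r p h) := by
  have h0 : 0 < r (src l) ^ (p + 1) := pow_pos (hr.pos _) _
  rw [hr.pow_map_unit_working hT hp, norm_smul, Real.norm_eq_abs, abs_of_pos h0]
  refine mul_le_mul_of_nonneg_left ((norm_sub_le _ _).trans (add_le_add ?_ ?_)) h0.le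
  · rw [← hr.pow_map_vec hT]; exact hr.norm_pow_map_vec_le hT _ _
  · rw [← hr.pow_map_vec hT]; exact hr.norm_pow_map_vec_le hT _ _

lemma exists_norm_pow_le {ε : ℝ} (hε : 0 < ε) (hε1 : ε < 1) :
    ∃ D : ℝ, 0 < D ∧ ∀ h, ‖T ^ h‖ ≤ D * ε ^ h := by
  obtain ⟨C, hC0, hC⟩ := hr.exists_prd_le hε hε1
  refine ⟨2 * C + 4 * C ^ 2 * ε⁻¹, by positivity, fun h => opNorm_le (by positivity) fun j => ?_⟩
  have hsmall : 2 * C * ε ^ h ≤ (2 * C + 4 * C ^ 2 * ε⁻¹) * ε ^ h :=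
    mul_le_mul_of_nonneg_right (le_add_of_nonneg_right (by positivity)) (by positivity)
  rcases cases_pos j with ⟨l, p, hp, rfl⟩ | hj
  · rcases le_or_gt (p + h) (bnd (src l)) with hph | hph
    · rw [hr.pow_map_unit_inner hT hph, norm_smul, norm_unit, mul_one, Real.norm_eq_abs,
        abs_of_nonneg (mul_nonneg (hr.prd_pos _ _).le (pow_nonneg (hr.inv_nonneg _) _))]
      refine le_trans ?_ hsmall
      have h1 : ((r (src l))⁻¹) ^ h ≤ 1 := pow_le_one₀ (hr.inv_nonneg _) (hr.inv_le_one _)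
      have h2 := mul_le_mul (hC p h) h1 (pow_nonneg (hr.inv_nonneg _) _) (by positivity)
      have : 0 < C * ε ^ h := by positivity
      linarith
    · refine (hr.norm_pow_map_unit_working hT hp).trans ?_
      have hA : 0 < r (src l) ^ (p + 1) := pow_pos (hr.pos _) _
      have h1 := hr.prd_mul_le hε hC (j := mid l + p) (h := h) (q := bnd (l + 1))
        (by rw [bnd_succ]; omega) (by rw [bnd_succ]; omega)
      have h2 := hr.prd_mul_le hε hC (j := p) (h := h) (q := bnd (src l)) hp hph
      rw [wt_bnd] at h1 h2
      have hq := hr.inv_sq_le (src l)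
      have e1 := (hr.pow_mul_eta_le hp ((src_le l).trans (Nat.le_succ l))).trans hq
      have e2 := (hr.pow_mul_eta_le hp (le_refl (src l))).trans hq
      have hK : 0 < C ^ 2 * ε ^ h := by positivity
      have f1 : r (src l) ^ (p + 1) * (prd r (mid l + p) h * ε) ≤ C ^ 2 * ε ^ h := by
        refine (mul_le_mul_of_nonneg_left h1 hA.le).trans ?_
        nlinarith
      have f2 : r (src l) ^ (p + 1) * (prd r p h * ε) ≤ C ^ 2 * ε ^ h := by
        refine (mul_le_mul_of_nonneg_left h2 hA.le).trans ?_
        nlinarith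
      have f3 : r (src l) ^ (p + 1) * (2 * prd r (mid l + p) h + 2 * prd r p h) ≤
          4 * C ^ 2 * ε⁻¹ * ε ^ h := by
        rw [mul_right_comm, mul_assoc 4, ← div_eq_mul_inv, le_div_iff₀ hε]
        linarith
      refine f3.trans (mul_le_mul_of_nonneg_right (le_add_of_nonneg_left ?_) ?_) <;> positivity
  · rw [← vec_layoff r hj]
    refine (hr.norm_pow_map_vec_le hT h j).trans (le_trans ?_ hsmall)
    have := hC j h
    linarith

lemma quasinilpotent : Tendsto (fun n : ℕ => ‖T ^ n‖ ^ (1 / (n : ℝ))) atTop (nhds 0) :=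
  tendsto_root_zero (fun _ => norm_nonneg _) fun _ h1 h2 => hr.exists_norm_pow_le hT h1 h2

end Operator

end Params

end Read

namespace Read

lemma exists_convolution_inverse {d : ℕ → ℝ} {a n₀ : ℕ} (h₀ : n₀ < a)
    (hd : ∃ k ≤ n₀, d k ≠ 0) :
    ∃ θ : ℕ → ℝ, (∀ h < a - n₀, θ h = 0) ∧
      ∀ q, ∑ h ∈ Finset.range (q + 1), θ h * d (q - h) = if q = a then 1 else 0 := by
  classical
  have hex : ∃ k, d k ≠ 0 := hd.imp fun _ h => h.2
  obtain ⟨k, hk, hmin⟩ : ∃ k, d k ≠ 0 ∧ ∀ m < k, d m = 0 :=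
    ⟨Nat.find hex, Nat.find_spec hex, fun m hm => not_not.1 (Nat.find_min hex hm)⟩
  have hkn : k ≤ n₀ := by
    obtain ⟨k', hk', hne⟩ := hd
    by_contra! h
    exact hne (hmin k' (by omega))
  set U : PowerSeries ℝ := PowerSeries.mk fun n => d (n + k) with hU
  have hDU : PowerSeries.mk d = PowerSeries.X ^ k * U := by
    ext n
    rw [PowerSeries.coeff_X_pow_mul', PowerSeries.coeff_mk, hU]
    split_ifs with h
    · rw [PowerSeries.coeff_mk, Nat.sub_add_cancel h]
    · exact hmin n (by omega)
  have hU0 : PowerSeries.constantCoeff U ≠ 0 := by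
    rw [← PowerSeries.coeff_zero_eq_constantCoeff_apply, hU, PowerSeries.coeff_mk, zero_add]
    exact hk
  refine ⟨fun h => PowerSeries.coeff h (PowerSeries.X ^ (a - k) * U⁻¹), fun h hh => ?_,
    fun q => ?_⟩
  · dsimp only
    rw [PowerSeries.coeff_X_pow_mul', if_neg (by omega)]
  · have hprod : PowerSeries.X ^ (a - k) * U⁻¹ * PowerSeries.mk d = PowerSeries.X ^ a := by
      calc _ = PowerSeries.X ^ (a - k) * PowerSeries.X ^ k * (U⁻¹ * U) := by rw [hDU]; ring
        _ = _ := by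
          rw [PowerSeries.inv_mul_cancel _ hU0, mul_one, ← pow_add,
            Nat.sub_add_cancel (by omega)]
    have := congrArg (PowerSeries.coeff q) hprod
    rw [PowerSeries.coeff_mul, PowerSeries.coeff_X_pow,
      Finset.Nat.sum_antidiagonal_eq_sum_range_succ_mk] at this
    simpa using this

/-- Bounded approximate inverses for convolution, uniformly on a compact set of sequences. -/
lemma exists_bounded_multipliers {a n₀ : ℕ} (b : ℕ) (h₀ : n₀ < a) {R : ℝ} (hR : 0 < R) :
    ∃ C : ℝ, 0 ≤ C ∧ ∀ d : ℕ → ℝ, (∀ k, |d k| ≤ R) → (∃ k ≤ n₀, R⁻¹ ≤ |d k|) →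
      ∃ θ : ℕ → ℝ, (∀ h ≤ b, |θ h| ≤ C) ∧ (∀ h < a - n₀, θ h = 0) ∧
        ∀ q ≤ b, |∑ h ∈ Finset.range (q + 1), θ h * d (q - h) - if q = a then 1 else 0| ≤
          R⁻¹ := by
  set K : Set (ℕ → ℝ) :=
    (Set.univ.pi fun _ => Set.Icc (-R) R) ∩ ⋃ k ∈ Finset.range (n₀ + 1), {d | R⁻¹ ≤ |d k|}
    with hKdef
  have hK : IsCompact K := by
    refine (isCompact_univ_pi fun _ => isCompact_Icc).inter_right ?_
    refine isClosed_biUnion_finset fun k _ => ?_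
    exact isClosed_le continuous_const (continuous_apply k).abs
  have main : ∃ C : ℝ, 0 ≤ C ∧ ∀ d ∈ K, ∃ θ : ℕ → ℝ, (∀ h ≤ b, |θ h| ≤ C) ∧
      (∀ h < a - n₀, θ h = 0) ∧
        ∀ q ≤ b, |∑ h ∈ Finset.range (q + 1), θ h * d (q - h) - if q = a then 1 else 0| ≤
          R⁻¹ := by
    refine hK.induction_on (p := fun s => ∃ C : ℝ, 0 ≤ C ∧ ∀ d ∈ s, ∃ θ : ℕ → ℝ,
      (∀ h ≤ b, |θ h| ≤ C) ∧ (∀ h < a - n₀, θ h = 0) ∧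
        ∀ q ≤ b, |∑ h ∈ Finset.range (q + 1), θ h * d (q - h) - if q = a then 1 else 0| ≤
          R⁻¹) ⟨0, le_rfl, by simp⟩ ?_ ?_ ?_
    · rintro s t hst ⟨C, hC, h⟩
      exact ⟨C, hC, fun d hd => h d (hst hd)⟩
    · rintro s t ⟨C, hC, h⟩ ⟨C', hC', h'⟩
      refine ⟨max C C', le_max_of_le_left hC, fun d hd => ?_⟩
      rcases hd with hd | hd
      · obtain ⟨θ, h1, h2, h3⟩ := h d hd
        exact ⟨θ, fun k hk => (h1 k hk).trans (le_max_left _ _), h2, h3⟩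
      · obtain ⟨θ, h1, h2, h3⟩ := h' d hd
        exact ⟨θ, fun k hk => (h1 k hk).trans (le_max_right _ _), h2, h3⟩
    · rintro d ⟨-, hd⟩
      simp only [Set.mem_iUnion, Finset.mem_range, Set.mem_ofPred_eq] at hd
      obtain ⟨k, hk, hdk⟩ := hd
      obtain ⟨θ, hθ, hconv⟩ := exists_convolution_inverse (d := d) h₀
        ⟨k, by omega, abs_pos.1 ((inv_pos.2 hR).trans_le hdk)⟩
      refine ⟨{d' | ∀ q ∈ Finset.range (b + 1),
        |∑ h ∈ Finset.range (q + 1), θ h * d' (q - h) - if q = a then 1 else 0| < R⁻¹},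
        mem_nhdsWithin_of_mem_nhds ?_, ∑ h ∈ Finset.range (b + 1), |θ h|,
        Finset.sum_nonneg fun _ _ => abs_nonneg _, fun d' hd' => ⟨θ, fun h hh => ?_, hθ,
          fun q hq => (hd' q (Finset.mem_range.2 (by omega))).le⟩⟩
      · refine (Filter.eventually_all_finset _).2 fun q _ => ?_
        have hcont : Continuous fun d' : ℕ → ℝ =>
            |∑ h ∈ Finset.range (q + 1), θ h * d' (q - h) - if q = a then 1 else 0| := by
          fun_prop
        refine hcont.continuousAt.eventually_lt_const ?_
        dsimp only
        rw [hconv q, sub_self, abs_zero]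
        exact inv_pos.2 hR
      · exact Finset.single_le_sum (f := fun h => |θ h|) (fun _ _ => abs_nonneg _)
          (Finset.mem_range.2 (by omega))
  obtain ⟨C, hC, h⟩ := main
  refine ⟨C, hC, fun d hd ⟨k, hk, hdk⟩ => h d ⟨?_, ?_⟩⟩
  · exact fun k _ => abs_le.1 (hd k)
  · simp only [Set.mem_iUnion, Finset.mem_range]
    exact ⟨k, by omega, hdk⟩

end Read

namespace Read

open L1

section Coefficients

variable (r : ℕ → ℝ)

/-- The columns of the functional extracting the coefficient of `vec r k`, where the working
positions copying a level above `i` are ignored. -/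
noncomputable def coefCol (i k j : ℕ) : ℝ :=
  (if j = k then amp r j else 0) -
    if Working j ∧ src (blk j) ≤ i ∧ j - mid (blk j) = k then amp r j else 0

/-- The largest scaling occurring at levels up to `i`. -/
noncomputable def ampBound (i : ℕ) (ρ : ℝ) : ℝ := ρ ^ (bnd i + 1)

/-- A bound for the inverse products of weights up to block `i`. -/
noncomputable def prdBound (i : ℕ) (ρ : ℝ) : ℝ := ρ ^ ((bnd i + 3) * bnd (i + 1))

/-- The size of the compact set of coefficient sequences considered at block `i`. -/
noncomputable def radius (i : ℕ) (ρ : ℝ) : ℝ :=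
  2 ^ bnd (i + 1) * (((i : ℝ) + 1) * (2 * ((bnd (i + 1) : ℝ) + 1) * prdBound i ρ)) * ampBound i ρ

/-- `C` bounds multipliers approximately inverting the coefficient sequences at block `i`. -/
def MultiplierBound (i : ℕ) (R C : ℝ) : Prop :=
  ∀ d : ℕ → ℝ, (∀ k, |d k| ≤ R) → (∃ k ≤ bnd i, R⁻¹ ≤ |d k|) →
    ∃ θ : ℕ → ℝ, (∀ h ≤ bnd (i + 1), |θ h| ≤ C) ∧ (∀ h < mid i - bnd i, θ h = 0) ∧
      ∀ q ≤ bnd (i + 1),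
        |∑ h ∈ Finset.range (q + 1), θ h * d (q - h) - if q = mid i then 1 else 0| ≤ R⁻¹

/-- The rapid growth condition on the parameters. -/
def Growth : Prop := ∀ i : ℕ, ∃ C : ℝ, 0 ≤ C ∧ MultiplierBound i (radius i (r i)) C ∧
  6 * ((i : ℝ) + 1) * ((bnd (i + 1) : ℝ) + 1) ^ 2 * C * prdBound i (r i) * ampBound i (r i) ≤
    r (i + 1)

end Coefficients

lemma src_blk_le {i j : ℕ} (h : j ≤ bnd (i + 1)) : src (blk j) ≤ i :=
  (src_le _).trans (blk_le h)

lemma exists_params : ∃ r : ℕ → ℝ, Params r ∧ Growth r := by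
  have hC : ∀ (i : ℕ) (ρ : ℝ), ∃ C : ℝ, 0 ≤ C ∧
      (0 < radius i ρ → MultiplierBound i (radius i ρ) C) := by
    intro i ρ
    by_cases hR : 0 < radius i ρ
    · obtain ⟨C, hC, h⟩ := exists_bounded_multipliers (bnd (i + 1)) (bnd_lt_mid i) hR
      exact ⟨C, hC, fun _ => h⟩
    · exact ⟨0, le_rfl, fun h => absurd h hR⟩
  choose C hC0 hC using hC
  let step : ℕ → ℝ → ℝ := fun i ρ => max (max ρ (2 ^ (i + 2)))
    (6 * ((i : ℝ) + 1) * ((bnd (i + 1) : ℝ) + 1) ^ 2 * C i ρ * prdBound i ρ * ampBound i ρ)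
  let r : ℕ → ℝ := fun n => Nat.rec 2 step n
  have hs : ∀ i, r (i + 1) = step i (r i) := fun _ => rfl
  have h2 : ∀ i, 2 ^ (i + 1) ≤ r i := by
    intro i
    cases i with
    | zero => simp [r]
    | succ i => rw [hs]; exact (le_max_right _ _).trans (le_max_left _ _)
  refine ⟨r, ⟨h2, monotone_nat_of_le_succ fun i => ?_⟩, fun i => ⟨C i (r i), hC0 _ _, ?_, ?_⟩⟩
  · rw [hs]; exact (le_max_left _ _).trans (le_max_left _ _)
  · have : 0 < r i := lt_of_lt_of_le (by positivity) (h2 i)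
    exact hC i (r i) (by unfold radius prdBound ampBound; positivity)
  · rw [hs]; exact le_max_right _ _

namespace Params

variable {r : ℕ → ℝ} (hr : Params r)
include hr

lemma one_le_ampBound (i : ℕ) : 1 ≤ ampBound i (r i) := one_le_pow₀ (hr.one_le i)

lemma one_le_prdBound (i : ℕ) : 1 ≤ prdBound i (r i) := one_le_pow₀ (hr.one_le i)

lemma pow_le_ampBound {i s p : ℕ} (hp : p ≤ bnd s) (hs : s ≤ i) :
    r s ^ (p + 1) ≤ ampBound i (r i) :=
  (pow_le_pow_left₀ (hr.pos s).le (hr.mono hs) _).trans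
    (pow_le_pow_right₀ (hr.one_le i) (by have := bnd_strictMono.monotone hs; omega))

lemma amp_le {i j : ℕ} (h : Working j → src (blk j) ≤ i) : amp r j ≤ ampBound i (r i) := by
  rcases cases_pos j with ⟨l, p, hp, rfl⟩ | hj
  · have h := h (working_mid hp)
    rw [blk_mid hp] at h
    rw [amp_mid r hp]
    exact hr.pow_le_ampBound hp h
  · rw [amp, if_neg hj]
    exact hr.one_le_ampBound i

lemma abs_coefCol_le_max (i k j : ℕ) :
    |coefCol r i k j| ≤ max (amp r k) (ampBound i (r i)) := by
  have h1 := hr.amp_ge_one j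
  unfold coefCol
  split_ifs with h2 h3 h3
  · exfalso
    have : 0 < mid (blk j) := by unfold mid; omega
    have : mid (blk j) ≤ j := h3.1
    omega
  · subst h2
    rw [sub_zero, abs_of_nonneg (by linarith)]
    exact le_max_left _ _
  · rw [zero_sub, abs_neg, abs_of_nonneg (by linarith)]
    exact (hr.amp_le fun _ => h3.2.1).trans (le_max_right _ _)
  · simp only [sub_zero, abs_zero]
    exact (zero_le_one.trans (hr.one_le_ampBound i)).trans (le_max_right _ _)

/-- The functional extracting the coefficient of `vec r k` up to level `i`. -/
noncomputable def coef (i k : ℕ) : L1 →L[ℝ] ℝ :=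
  ofCols (coefCol r i k) (max (amp r k) (ampBound i (r i)))
    fun j => by rw [Real.norm_eq_abs]; exact hr.abs_coefCol_le_max i k j

lemma coef_unit (i k j : ℕ) : hr.coef i k (unit j) = coefCol r i k j := ofCols_unit _ _ _ _

lemma abs_coef_le {i k : ℕ} (hk : k ≤ bnd (i + 1)) {x : L1} (hx : ‖x‖ ≤ 1) :
    |hr.coef i k x| ≤ ampBound i (r i) := by
  have h0 := zero_le_one.trans (hr.one_le_ampBound i)
  have h : ‖hr.coef i k‖ ≤ ampBound i (r i) := opNorm_le h0 fun j => by
    rw [hr.coef_unit, Real.norm_eq_abs]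
    exact (hr.abs_coefCol_le_max i k j).trans
      (max_le (hr.amp_le fun _ => src_blk_le hk) le_rfl)
  have h2 := (hr.coef i k).le_opNorm x
  rw [Real.norm_eq_abs] at h2
  nlinarith [norm_nonneg x]

/-- The partial expansion in the orbit basis with `N + 1` terms. -/
noncomputable def expand (i N : ℕ) : L1 →L[ℝ] L1 :=
  ∑ k ∈ Finset.range (N + 1), (hr.coef i k).smulRight (vec r k)

lemma expand_apply (i N : ℕ) (x : L1) :
    hr.expand i N x = ∑ k ∈ Finset.range (N + 1), hr.coef i k x • vec r k := by
  simp [expand]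

lemma expand_unit (i N j : ℕ) :
    hr.expand i N (unit j) = (if j ≤ N then amp r j • vec r j else 0) -
      if Working j ∧ src (blk j) ≤ i ∧ j - mid (blk j) ≤ N then
        amp r j • vec r (j - mid (blk j)) else 0 := by
  simp only [hr.expand_apply, hr.coef_unit, coefCol, sub_smul, Finset.sum_sub_distrib]
  congr 1
  · simp [ite_smul]
  · by_cases h : Working j ∧ src (blk j) ≤ i
    · simp [h.1, h.2, ite_smul]
    · have h' : ∀ P : Prop, ¬ (Working j ∧ src (blk j) ≤ i ∧ P) := fun P hP => h ⟨hP.1, hP.2.1⟩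
      simp [h']

lemma expand_unit_known {i N l p : ℕ} (hp : p ≤ bnd (src l)) (hl : src l ≤ i) (hpN : p ≤ N) :
    hr.expand i N (unit (mid l + p)) =
      (if mid l + p ≤ N then r (src l) ^ (p + 1) • vec r (mid l + p) else 0) -
        r (src l) ^ (p + 1) • vec r p := by
  rw [hr.expand_unit, amp_mid r hp, blk_mid hp, Nat.add_sub_cancel_left,
    if_pos (c := _ ∧ _ ∧ _) ⟨working_mid hp, hl, hpN⟩]

lemma unit_mid {l p : ℕ} (hp : p ≤ bnd (src l)) :
    unit (mid l + p) = r (src l) ^ (p + 1) • vec r (mid l + p) - r (src l) ^ (p + 1) • vec r p := by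
  have h0 : r (src l) ^ (p + 1) ≠ 0 := pow_ne_zero _ (hr.pos _).ne'
  rw [← smul_sub, vec_mid r hp, add_sub_cancel_right, smul_smul, mul_inv_cancel₀ h0, one_smul]

lemma expand_unit_of_le {i N j : ℕ} (hN : N ≤ bnd (i + 1)) (hj : j ≤ N) :
    hr.expand i N (unit j) = unit j := by
  rcases cases_pos j with ⟨l, p, hp, rfl⟩ | hw
  · have hl := src_blk_le (hj.trans hN)
    rw [blk_mid hp] at hl
    rw [hr.expand_unit_known hp hl (by omega), if_pos hj, ← hr.unit_mid hp]
  · rw [hr.expand_unit, if_pos hj, if_neg (fun h => hw h.1), amp, if_neg hw, one_smul,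
      vec_layoff r hw, sub_zero]

lemma expand_unit_layoff {i N j : ℕ} (hj : N < j) (hw : ¬ Working j) :
    hr.expand i N (unit j) = 0 := by
  rw [hr.expand_unit, if_neg (by omega), if_neg (fun h => hw h.1), sub_zero]

lemma expand_unit_new {i N l p : ℕ} (hj : N < mid l + p) (hp : p ≤ bnd (src l))
    (hl : i < src l) : hr.expand i N (unit (mid l + p)) = 0 := by
  rw [hr.expand_unit, if_neg (by omega), blk_mid hp, if_neg (fun h => by omega), sub_zero]

end Params

end Read

namespace Read

open L1

namespace Params

variable {r : ℕ → ℝ} (hr : Params r)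
include hr

lemma eta_le_wt {i q : ℕ} (hq : q < bnd (i + 1)) : eta r i ≤ wt r q := by
  induction q using Nat.strong_induction_on with
  | _ q ih =>
    rcases cases_wt q with ⟨l, h1, h2⟩ | ⟨l, p, hp, rfl⟩
    · rw [wt_layoff r h1 h2]
      exact hr.eta_anti (Nat.lt_succ_iff.1 (bnd_strictMono.lt_iff_lt.1 (h1.trans_lt hq)))
    · rw [wt_copy r hp]
      exact ih p (by unfold mid; omega) (by omega)

lemma inv_prd_le {i k : ℕ} (hk : k ≤ bnd (i + 1)) : (prd r 0 k)⁻¹ ≤ prdBound i (r i) := by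
  have h1 : eta r i ^ k ≤ prd r 0 k := by
    have : eta r i ^ k = ∏ _q ∈ Finset.range k, eta r i := by simp
    rw [this, prd]
    refine Finset.prod_le_prod (fun _ _ => (hr.eta_pos i).le) fun q hq => ?_
    have := Finset.mem_range.1 hq
    exact hr.eta_le_wt (by omega)
  refine (inv_anti₀ (pow_pos (hr.eta_pos i) k) h1).trans ?_
  unfold eta prdBound
  rw [← pow_mul, inv_pow, inv_inv]
  exact pow_le_pow_right₀ (hr.one_le i) (Nat.mul_le_mul_left _ hk)

lemma eta_le_inv_of_le {i l : ℕ} (h : i ≤ l) : eta r l ≤ (r i)⁻¹ :=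
  (hr.eta_le_inv l).trans (hr.inv_anti h)

lemma norm_sum_overflow_le {i : ℕ} {θ : ℕ → ℝ} {D : ℝ} (hD : 0 ≤ D)
    (hθ : ∀ h ≤ bnd (i + 1), |θ h| ≤ D) {x : L1} (hx : ‖x‖ ≤ 1) :
    ‖∑ h ∈ Finset.range (bnd (i + 1) + 1),
      ∑ k ∈ Finset.Ico (bnd (i + 1) + 1 - h) (bnd (i + 1) + 1),
        (θ h * hr.coef i k x * prd r k h) • vec r (k + h)‖ ≤
      (bnd (i + 1) + 1) * ((bnd (i + 1) + 1) *
        (D * ampBound i (r i) * (r (i + 1))⁻¹ * 2)) := by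
  have hB := hr.one_le_ampBound i
  have hi := hr.inv_nonneg (i + 1)
  have hnn : 0 ≤ D * ampBound i (r i) * (r (i + 1))⁻¹ * 2 := by positivity
  refine (norm_sum_le_of_le (n := fun _ => ((bnd (i + 1) : ℝ) + 1) *
        (D * ampBound i (r i) * (r (i + 1))⁻¹ * 2)) _ fun h hh => ?_).trans (by simp)
  rw [Finset.mem_range] at hh
  refine (norm_sum_le_of_le (n := fun _ => D * ampBound i (r i) * (r (i + 1))⁻¹ * 2) _
    fun k hk => ?_).trans ?_
  · rw [Finset.mem_Ico] at hk
    have h1 : prd r k h ≤ (r (i + 1))⁻¹ := by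
      refine le_trans ?_ (hr.eta_le_inv (i + 1))
      rw [← wt_bnd]
      exact hr.prd_le_wt (by omega) (by omega)
    rw [norm_smul, Real.norm_eq_abs, abs_mul, abs_mul, abs_of_pos (hr.prd_pos k h)]
    have h2 := hr.abs_coef_le (i := i) (k := k) (by omega) hx
    refine mul_le_mul (mul_le_mul (mul_le_mul (hθ h (by omega)) h2 (abs_nonneg _) hD) h1
      (hr.prd_pos _ _).le (by positivity)) (hr.norm_vec_le_two _) (norm_nonneg _) (by positivity)
  · rw [Finset.sum_const, Nat.card_Ico, nsmul_eq_mul]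
    refine mul_le_mul_of_nonneg_right ?_ hnn
    exact_mod_cast (by omega : bnd (i + 1) + 1 - (bnd (i + 1) + 1 - h) ≤ bnd (i + 1) + 1)

section Operator

variable {T : L1 →L[ℝ] L1} (hT : ∀ j, T (unit j) = col r j)
include hT

/-- Powers of the operator are small on the tail of the partial expansion. -/
lemma norm_pow_map_tail_le {i h : ℕ} (hh : bnd i < h) (j : ℕ) :
    ‖(T ^ h) (unit j - hr.expand i (bnd (i + 1)) (unit j))‖ ≤
      4 * ampBound i (r i) * (r (i + 1))⁻¹ := by
  have hB := hr.one_le_ampBound i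
  have hi := hr.inv_nonneg (i + 1)
  rcases le_or_gt j (bnd (i + 1)) with hj | hj
  · rw [hr.expand_unit_of_le le_rfl hj, sub_self, map_zero, norm_zero]
    positivity
  have hlt : ∀ l, j ≤ bnd (l + 1) → i + 1 ≤ l := fun l hl =>
    Nat.lt_succ_iff.1 (bnd_strictMono.lt_iff_lt.1 (hj.trans_le hl))
  have hBi : (r (i + 1))⁻¹ ≤ ampBound i (r i) * (r (i + 1))⁻¹ :=
    le_mul_of_one_le_left hi hB
  rcases cases_pos j with ⟨l, p, hp, rfl⟩ | hw
  · have hl := hlt l (by rw [bnd_succ]; omega)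
    have hA : 0 < r (src l) ^ (p + 1) := pow_pos (hr.pos _) _
    rcases le_or_gt (src l) i with hs | hs
    · have hbs := bnd_strictMono.monotone hs
      have hpN : p ≤ bnd (i + 1) := by
        have := bnd_strictMono.monotone (Nat.le_succ i)
        rw [Nat.succ_eq_add_one] at this
        omega
      rw [hr.expand_unit_known hp hs hpN, if_neg (by omega), zero_sub, sub_neg_eq_add,
        hr.unit_mid hp, sub_add_cancel, map_smul, norm_smul, Real.norm_eq_abs, abs_of_pos hA]
      have h1 := hr.norm_pow_map_vec_le hT h (mid l + p)
      have h2 : prd r (mid l + p) h ≤ eta r (l + 1) := by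
        rw [← wt_bnd]
        exact hr.prd_le_wt (by rw [bnd_succ]; omega) (by rw [bnd_succ]; omega)
      have h3 := hr.eta_le_inv_of_le (show i + 1 ≤ l + 1 by omega)
      calc _ ≤ ampBound i (r i) * (2 * (r (i + 1))⁻¹) :=
            mul_le_mul (hr.pow_le_ampBound hp hs) (by linarith) (norm_nonneg _) (by linarith)
        _ ≤ _ := by nlinarith
    · rw [hr.expand_unit_new hj hp hs, sub_zero]
      have hsi := hr.inv_anti (show i + 1 ≤ src l from hs)
      have hs0 := hr.inv_nonneg (src l)
      have hs1 := hr.inv_le_one (src l)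
      rcases le_or_gt (p + h) (bnd (src l)) with hph | hph
      · rw [hr.pow_map_unit_inner hT hph, norm_smul, norm_unit, mul_one, Real.norm_eq_abs,
          abs_of_nonneg (mul_nonneg (hr.prd_pos _ _).le (pow_nonneg hs0 _))]
        have h1 : ((r (src l))⁻¹) ^ h ≤ (r (src l))⁻¹ := by
          simpa using pow_le_pow_of_le_one hs0 hs1 (show 1 ≤ h by omega)
        have h2 := mul_le_mul (hr.prd_le_one p h) h1 (pow_nonneg hs0 _) zero_le_one
        nlinarith
      · refine (hr.norm_pow_map_unit_working hT hp).trans ?_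
        have h1 : prd r (mid l + p) h ≤ eta r (l + 1) := by
          rw [← wt_bnd]
          exact hr.prd_le_wt (by rw [bnd_succ]; omega) (by rw [bnd_succ]; omega)
        have h2 : prd r p h ≤ eta r (src l) := by
          rw [← wt_bnd]
          exact hr.prd_le_wt hp hph
        have e1 := hr.pow_mul_eta_le hp ((src_le l).trans (Nat.le_succ l))
        have e2 := hr.pow_mul_eta_le hp (le_refl (src l))
        have f1 := mul_le_mul_of_nonneg_left h1 hA.le
        have f2 := mul_le_mul_of_nonneg_left h2 hA.le
        nlinarith
  · rw [hr.expand_unit_layoff hj hw, sub_zero, ← vec_layoff r hw]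
    have h1 := hr.norm_pow_map_vec_le hT h j
    have h2 : prd r j h ≤ wt r j := hr.prd_le_wt le_rfl (by omega)
    have h3 : wt r j ≤ (r (i + 1))⁻¹ := by
      rcases cases_wt j with ⟨l, h1, h2⟩ | ⟨l, p, hp, rfl⟩
      · rw [wt_layoff r h1 h2]
        exact hr.eta_le_inv_of_le (hlt l (h2.le.trans (mid_le l)))
      · exact absurd (working_mid hp.le) hw
    linarith

/-- Polynomials of the operator applied to a partial expansion in the orbit basis. -/
lemma sum_smul_pow_map_expand (i N : ℕ) (θ d : ℕ → ℝ) (γ : ℝ) (x : L1)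
    (hd : ∀ k ≤ N, hr.coef i k x = d k * prd r 0 k) :
    ∑ h ∈ Finset.range (N + 1), (γ * θ h) • (T ^ h) (hr.expand i N x) =
      ∑ q ∈ Finset.range (N + 1),
        (γ * prd r 0 q * ∑ h ∈ Finset.range (q + 1), θ h * d (q - h)) • vec r q +
      ∑ h ∈ Finset.range (N + 1), ∑ k ∈ Finset.Ico (N + 1 - h) (N + 1),
        (γ * θ h * hr.coef i k x * prd r k h) • vec r (k + h) := by
  have h1 : ∀ h, (γ * θ h) • (T ^ h) (hr.expand i N x) =
      ∑ k ∈ Finset.range (N + 1), (γ * θ h * hr.coef i k x * prd r k h) • vec r (k + h) := by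
    intro h
    rw [hr.expand_apply, map_sum, Finset.smul_sum]
    refine Finset.sum_congr rfl fun k _ => ?_
    rw [map_smul, hr.pow_map_vec hT, smul_smul, smul_smul, mul_assoc, mul_assoc]
  simp only [h1]
  rw [Finset.sum_congr rfl fun h _ => (Finset.sum_range_add_sum_Ico _ (Nat.sub_le (N + 1) h)).symm,
    Finset.sum_add_distrib,
    ← Finset.sum_range_diag_flip (N + 1)
      fun h k => (γ * θ h * hr.coef i k x * prd r k h) • vec r (k + h)]
  congr 1
  refine Finset.sum_congr rfl fun q hq => ?_
  rw [Finset.mul_sum, Finset.sum_smul]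
  refine Finset.sum_congr rfl fun h hh => ?_
  rw [Finset.mem_range] at hq hh
  have hqh : q - h + h = q := Nat.sub_add_cancel (by omega)
  rw [hd (q - h) (by omega), hqh]
  congr 1
  have := prd_add r 0 (q - h) h
  rw [hqh, zero_add] at this
  rw [this]
  ring

lemma norm_sum_pow_map_tail_le {i : ℕ} {θ : ℕ → ℝ} {D : ℝ} (hD : 0 ≤ D) (N : ℕ)
    (hθ : ∀ h ≤ N, |θ h| ≤ D) (hθ0 : ∀ h ≤ bnd i, θ h = 0) {x : L1} (hx : ‖x‖ ≤ 1) :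
    ‖∑ h ∈ Finset.range (N + 1), θ h • (T ^ h) (x - hr.expand i (bnd (i + 1)) x)‖ ≤
      (N + 1) * (D * (4 * ampBound i (r i) * (r (i + 1))⁻¹)) := by
  have hB := hr.one_le_ampBound i
  have hi := hr.inv_nonneg (i + 1)
  have hnn : 0 ≤ 4 * ampBound i (r i) * (r (i + 1))⁻¹ := by positivity
  have := norm_sum_le_of_le (f := fun h => θ h • (T ^ h) (x - hr.expand i (bnd (i + 1)) x))
    (n := fun _ => D * (4 * ampBound i (r i) * (r (i + 1))⁻¹)) (Finset.range (N + 1)) ?_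
  · simpa using this
  intro h hh
  rw [Finset.mem_range] at hh
  rcases le_or_gt h (bnd i) with h1 | h1
  · rw [hθ0 h h1, zero_smul, norm_zero]
    positivity
  rw [norm_smul, Real.norm_eq_abs]
  refine mul_le_mul (hθ h (by omega)) ?_ (norm_nonneg _) hD
  have h2 : ‖(T ^ h).comp (ContinuousLinearMap.id ℝ L1 - hr.expand i (bnd (i + 1)))‖ ≤
      4 * ampBound i (r i) * (r (i + 1))⁻¹ :=
    opNorm_le hnn fun j => by simpa using hr.norm_pow_map_tail_le hT h1 j
  have h3 := ContinuousLinearMap.le_of_opNorm_le _ h2 x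
  have h4 : ‖(T ^ h) (x - hr.expand i (bnd (i + 1)) x)‖ ≤
      4 * ampBound i (r i) * (r (i + 1))⁻¹ * ‖x‖ := by simpa using h3
  nlinarith

/-- If some low coefficient of `x` at block `i` is not too small, a polynomial in the operator
moves `x` close to the cyclic vector `unit 0`. -/
lemma exists_polynomial_near (hg : Growth r) {i : ℕ} {x : L1} (hx : ‖x‖ ≤ 1)
    (hlow : ∃ k ≤ bnd i, ((2 : ℝ) ^ bnd (i + 1))⁻¹ ≤ |hr.coef i k x|) :
    ∃ θ : ℕ → ℝ, ‖∑ h ∈ Finset.range (bnd (i + 1) + 1), θ h • (T ^ h) x - unit 0‖ ≤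
      (r (src i))⁻¹ + 2 / ((i : ℝ) + 1) := by
  obtain ⟨C, hC0, hC, hCr⟩ := hg i
  set N := bnd (i + 1) with hN
  set W := prdBound i (r i) with hW
  set B := ampBound i (r i) with hB
  set R := radius i (r i) with hR
  have hW1 : 1 ≤ W := hr.one_le_prdBound i
  have hB1 : 1 ≤ B := hr.one_le_ampBound i
  have hi1 : (1 : ℝ) ≤ i + 1 := by linarith [(Nat.cast_nonneg i : (0 : ℝ) ≤ i)]
  have hN1 : (1 : ℝ) ≤ (N : ℝ) + 1 := by linarith [(Nat.cast_nonneg N : (0 : ℝ) ≤ N)]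
  have h2N : (1 : ℝ) ≤ 2 ^ N := one_le_pow₀ one_le_two
  have hRdef : R = 2 ^ N * (((i : ℝ) + 1) * (2 * ((N : ℝ) + 1) * W)) * B := rfl
  set Y := ((i : ℝ) + 1) * (2 * ((N : ℝ) + 1) * W) with hY
  have hYW : W ≤ Y := by
    have : 1 ≤ ((i : ℝ) + 1) * (2 * ((N : ℝ) + 1)) := by nlinarith
    have := mul_le_mul_of_nonneg_right this (zero_le_one.trans hW1)
    rw [hY]
    linarith
  have hY1 : 1 ≤ Y := hW1.trans hYW
  have hR1 : 2 ^ N ≤ R := by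
    rw [hRdef]
    have : 1 ≤ Y * B := one_le_mul_of_one_le_of_one_le hY1 hB1
    nlinarith
  have hR2 : Y ≤ R := by
    rw [hRdef]
    have : 1 ≤ 2 ^ N * B := one_le_mul_of_one_le_of_one_le h2N hB1
    nlinarith
  have hR3 : B * W ≤ R := by
    rw [hRdef]
    calc B * W ≤ B * Y := by gcongr
      _ = 1 * Y * B := by ring
      _ ≤ _ := by gcongr
  have hR0 : 0 < R := by linarith
  set d : ℕ → ℝ := fun k => if k ≤ N then hr.coef i k x * (prd r 0 k)⁻¹ else 0 with hd
  have hprd : ∀ k, 1 ≤ (prd r 0 k)⁻¹ := fun k =>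
    (one_le_inv₀ (hr.prd_pos 0 k)).2 (hr.prd_le_one 0 k)
  have hdle : ∀ k, |d k| ≤ R := by
    intro k
    simp only [hd]
    split_ifs with hk
    · rw [abs_mul, abs_of_pos (zero_lt_one.trans_le (hprd k))]
      exact (mul_le_mul (hr.abs_coef_le hk hx) (hr.inv_prd_le hk)
        (zero_le_one.trans (hprd k)) (by linarith)).trans hR3
    · simpa using hR0.le
  have hNi : bnd i ≤ N := (bnd_strictMono (Nat.lt_succ_self i)).le
  have hdlow : ∃ k ≤ bnd i, R⁻¹ ≤ |d k| := by
    obtain ⟨k, hk, hck⟩ := hlow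
    refine ⟨k, hk, ?_⟩
    simp only [hd, if_pos (hk.trans hNi)]
    rw [abs_mul, abs_of_pos (zero_lt_one.trans_le (hprd k))]
    exact (inv_anti₀ (by positivity) hR1).trans
      (hck.trans (le_mul_of_one_le_right (abs_nonneg _) (hprd k)))
  obtain ⟨θ, hθC, hθ0, hθ⟩ := hC d hdle hdlow
  set γ := (prd r 0 (mid i))⁻¹ with hγ
  have hγ1 : 1 ≤ γ := hprd _
  have haN : mid i ≤ N := mid_le i
  have hγW : γ ≤ W := hr.inv_prd_le haN
  have hγθ : ∀ h ≤ N, |γ * θ h| ≤ W * C := fun h hh => by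
    rw [abs_mul, abs_of_pos (by linarith)]
    exact mul_le_mul hγW (hθC h hh) (abs_nonneg _) (by linarith)
  have hγθ0 : ∀ h ≤ bnd i, γ * θ h = 0 := fun h hh => by
    rw [hθ0 h (by unfold mid; omega), mul_zero]
  have hWC : 0 ≤ W * C := by positivity
  refine ⟨fun h => γ * θ h, ?_⟩
  have hsplit : ∑ h ∈ Finset.range (N + 1), (γ * θ h) • (T ^ h) x - unit 0 =
      ∑ h ∈ Finset.range (N + 1), (γ * θ h) • (T ^ h) (x - hr.expand i N x) +
      (∑ q ∈ Finset.range (N + 1), (γ * prd r 0 q *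
        (∑ h ∈ Finset.range (q + 1), θ h * d (q - h) - if q = mid i then 1 else 0)) • vec r q +
      ∑ h ∈ Finset.range (N + 1), ∑ k ∈ Finset.Ico (N + 1 - h) (N + 1),
        (γ * θ h * hr.coef i k x * prd r k h) • vec r (k + h)) +
      (r (src i))⁻¹ • unit (mid i) := by
    have hva : (r (src i))⁻¹ • unit (mid i) = vec r (mid i) - unit 0 := by
      have := vec_mid r (l := i) (p := 0) (Nat.zero_le _)
      rw [add_zero, zero_add, pow_one, vec_zero] at this
      rw [this, add_sub_cancel_right]
    have hsum : ∑ q ∈ Finset.range (N + 1),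
        (γ * prd r 0 q * if q = mid i then (1 : ℝ) else 0) • vec r q = vec r (mid i) := by
      rw [Finset.sum_eq_single (mid i)]
      · rw [if_pos rfl, mul_one, hγ, inv_mul_cancel₀ (hr.prd_pos _ _).ne', one_smul]
      · intro q _ hq
        rw [if_neg hq, mul_zero, zero_smul]
      · intro h
        exact absurd (Finset.mem_range.2 (by omega)) h
    have hexp := hr.sum_smul_pow_map_expand hT i N θ d γ x fun k hk => by
      simp only [hd, if_pos hk]
      rw [mul_assoc, inv_mul_cancel₀ (hr.prd_pos _ _).ne', mul_one]
    simp only [map_sub, smul_sub, Finset.sum_sub_distrib, mul_sub, sub_smul]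
    rw [hexp, hsum, hva]
    abel
  rw [hsplit]
  have E1 := hr.norm_sum_pow_map_tail_le hT hWC N hγθ hγθ0 hx
  have E2 := hr.norm_sum_overflow_le hWC hγθ hx
  have E3 : ‖∑ q ∈ Finset.range (N + 1), (γ * prd r 0 q *
        (∑ h ∈ Finset.range (q + 1), θ h * d (q - h) - if q = mid i then 1 else 0)) • vec r q‖ ≤
      (N + 1) * (W * R⁻¹ * 2) := by
    refine (norm_sum_le_of_le (n := fun _ => W * R⁻¹ * 2) _ fun q hq => ?_).trans (by simp)
    rw [Finset.mem_range] at hq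
    rw [norm_smul, Real.norm_eq_abs, abs_mul, abs_mul, abs_of_pos (hr.prd_pos 0 q),
      abs_of_pos (show 0 < γ by linarith)]
    have h1 : γ * prd r 0 q ≤ W := by
      have := mul_le_mul hγW (hr.prd_le_one 0 q) (hr.prd_pos 0 q).le (by linarith)
      linarith
    exact mul_le_mul (mul_le_mul h1 (hθ q (by omega)) (abs_nonneg _) (by linarith))
      (hr.norm_vec_le_two q) (norm_nonneg _) (by positivity)
  have E4 : ‖(r (src i))⁻¹ • unit (mid i)‖ = (r (src i))⁻¹ := by
    rw [norm_smul, norm_unit, mul_one, Real.norm_eq_abs, abs_of_nonneg (hr.inv_nonneg _)]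
  have E5 : ((N : ℝ) + 1) * (W * R⁻¹ * 2) ≤ 1 / ((i : ℝ) + 1) := by
    rw [le_div_iff₀ (by linarith)]
    calc _ = Y * R⁻¹ := by rw [hY]; ring
      _ ≤ R * R⁻¹ := by gcongr
      _ = 1 := mul_inv_cancel₀ hR0.ne'
  have hri := hr.pos (i + 1)
  have E6 : ((N : ℝ) + 1) * (W * C * (4 * B * (r (i + 1))⁻¹)) +
      (N + 1) * ((N + 1) * (W * C * B * (r (i + 1))⁻¹ * 2)) ≤ 1 / ((i : ℝ) + 1) := by
    rw [le_div_iff₀ (by linarith)]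
    have hZ : 0 ≤ W * C * B * (r (i + 1))⁻¹ * (i + 1) := by positivity
    have hNN : (N : ℝ) + 1 ≤ (N + 1) ^ 2 := by nlinarith
    calc _ = (4 * ((N : ℝ) + 1) + 2 * (N + 1) ^ 2) *
          (W * C * B * (r (i + 1))⁻¹ * (i + 1)) := by ring
      _ ≤ (6 * ((N : ℝ) + 1) ^ 2) * (W * C * B * (r (i + 1))⁻¹ * (i + 1)) := by
          gcongr
          linarith
      _ = (6 * ((i : ℝ) + 1) * ((N : ℝ) + 1) ^ 2 * C * W * B) * (r (i + 1))⁻¹ := by ring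
      _ ≤ r (i + 1) * (r (i + 1))⁻¹ := by gcongr
      _ = 1 := mul_inv_cancel₀ hri.ne'
  have E7 : 2 / ((i : ℝ) + 1) = 1 / ((i : ℝ) + 1) + 1 / ((i : ℝ) + 1) := by ring
  refine (norm_add_le _ _).trans ?_
  rw [E4]
  have F1 := norm_add_le (∑ h ∈ Finset.range (N + 1), (γ * θ h) • (T ^ h) (x - hr.expand i N x))
    (∑ q ∈ Finset.range (N + 1), (γ * prd r 0 q *
        (∑ h ∈ Finset.range (q + 1), θ h * d (q - h) - if q = mid i then 1 else 0)) • vec r q +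
      ∑ h ∈ Finset.range (N + 1), ∑ k ∈ Finset.Ico (N + 1 - h) (N + 1),
        (γ * θ h * hr.coef i k x * prd r k h) • vec r (k + h))
  have F2 := norm_add_le (∑ q ∈ Finset.range (N + 1), (γ * prd r 0 q *
        (∑ h ∈ Finset.range (q + 1), θ h * d (q - h) - if q = mid i then 1 else 0)) • vec r q)
      (∑ h ∈ Finset.range (N + 1), ∑ k ∈ Finset.Ico (N + 1 - h) (N + 1),
        (γ * θ h * hr.coef i k x * prd r k h) • vec r (k + h))
  linarith

end Operator

end Params

end Read

namespace Read

open L1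

lemma src_le_sq {l n : ℕ} (h : src l ≤ n ^ 2 + n) : src l ≤ n ^ 2 := by
  unfold src at h ⊢
  refine Nat.pow_le_pow_left ?_ 2
  by_contra! hlt
  nlinarith

lemma lt_of_sq_lt_src {l m : ℕ} (h : m ^ 2 < src l) :
    m ≤ Nat.sqrt l ∧ l < Nat.sqrt l ^ 2 + (Nat.sqrt l - m) := by
  unfold src at h
  have h1 := lt_of_pow_lt_pow_left₀ 2 (Nat.zero_le _) h
  have := Nat.sqrt_le' l
  omega

namespace Params

variable {r : ℕ → ℝ} (hr : Params r)
include hr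

lemma coef_eq_amp_mul {l m p : ℕ} (hp : p ≤ bnd (src l)) (x : L1) :
    hr.coef (Nat.sqrt l ^ 2 + (Nat.sqrt l - m)) (mid l + p) x =
      r (src l) ^ (p + 1) * x (mid l + p) := by
  have : hr.coef (Nat.sqrt l ^ 2 + (Nat.sqrt l - m)) (mid l + p) =
      r (src l) ^ (p + 1) • coord (mid l + p) := by
    refine ext_unit fun j => ?_
    rw [hr.coef_unit, coefCol, if_neg (c := _ ∧ _ ∧ _), sub_zero]
    · change _ = r (src l) ^ (p + 1) • unit j (mid l + p)
      rw [unit_apply]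
      by_cases h : j = mid l + p
      · rw [if_pos h, if_pos h.symm, h, amp_mid r hp, smul_eq_mul, mul_one]
      · rw [if_neg h, if_neg fun h' => h h'.symm, smul_zero]
    · rintro ⟨hw, hs, he⟩
      obtain ⟨l', p', hp', rfl⟩ := working_iff.1 hw
      rw [blk_mid hp'] at hs he
      have h1 := src_le_sq (n := Nat.sqrt l) (l := l') (by omega)
      have h2 := bnd_strictMono.monotone (h1.trans (Nat.sqrt_le' l))
      have := bnd_lt_mid l
      omega
  rw [this]
  rfl

lemma norm_expand_le {i N : ℕ} {x : L1} {c : ℝ} (h : ∀ k ≤ N, |hr.coef i k x| ≤ c) :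
    ‖hr.expand i N x‖ ≤ (N + 1) * (c * 2) := by
  have hc : 0 ≤ c := (abs_nonneg _).trans (h 0 (Nat.zero_le _))
  rw [hr.expand_apply]
  refine (norm_sum_le_of_le (n := fun _ => c * 2) _ fun k hk => ?_).trans (by simp)
  rw [Finset.mem_range] at hk
  rw [norm_smul, Real.norm_eq_abs]
  exact mul_le_mul (h k (by omega)) (hr.norm_vec_le_two k) (norm_nonneg _) hc

/-- A vector all of whose low coefficients are tiny at all late enough blocks is zero. -/
lemma eq_zero_of_coef_small {m n₀ : ℕ} {x : L1}
    (h : ∀ n, n₀ ≤ n → m ≤ n → ∀ k ≤ bnd (n ^ 2 + (n - m)),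
      |hr.coef (n ^ 2 + (n - m)) k x| < ((2 : ℝ) ^ bnd (n ^ 2 + (n - m) + 1))⁻¹) : x = 0 := by
  set D := ampBound (m ^ 2) (r (m ^ 2)) with hD
  have hD1 : 1 ≤ D := hr.one_le_ampBound _
  set w : ℕ → ℝ := fun j => 2 * D * |x j| + 2 * (1 / 2) ^ j with hw
  have hw0 : ∀ j, 0 ≤ w j := fun j => by positivity
  have hwx : ∀ j, |x j| ≤ w j := fun j => by
    have : (0 : ℝ) < (1 / 2) ^ j := by positivity
    simp only [hw]
    nlinarith [abs_nonneg (x j)]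
  have htail : Tendsto (fun n => ∑' j, w (j + n)) atTop (𝓝 0) := tendsto_sum_nat_add w
  have hws : Summable w :=
    ((hasSum_norm x).summable.mul_left _).add (summable_geometric_two.mul_left 2)
  have key : ∀ n, n₀ ≤ n → m ≤ n → ‖x‖ ≤
      2 * (1 / 2) ^ n + ∑' j, w (j + (bnd (n ^ 2) + 1)) := by
    intro n hn hm
    set i := n ^ 2 + (n - m) with hi
    set N := bnd (n ^ 2) with hN
    have hNi : N ≤ bnd i := bnd_strictMono.monotone (by omega)
    have hnN : n ≤ N := (Nat.le_self_pow two_ne_zero n).trans (le_bnd _)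
    have h1 : ‖hr.expand i N x‖ ≤ 2 * (1 / 2) ^ n := by
      refine (hr.norm_expand_le fun k hk => (h n hn hm k (hk.trans hNi)).le).trans ?_
      have h2N : N + N ≤ bnd (i + 1) := by
        have := mid_le i
        unfold mid at this
        omega
      have h3 : ((2 : ℝ) ^ bnd (i + 1))⁻¹ ≤ ((2 : ℝ) ^ N)⁻¹ * ((2 : ℝ) ^ N)⁻¹ := by
        rw [← mul_inv, ← pow_add]
        exact inv_anti₀ (by positivity) (pow_le_pow_right₀ one_le_two h2N)
      have h4 : (N : ℝ) + 1 ≤ 2 ^ N := by exact_mod_cast Nat.lt_two_pow_self (n := N)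
      have h5 : ((2 : ℝ) ^ N)⁻¹ ≤ (1 / 2) ^ n := by
        rw [one_div, inv_pow]
        exact inv_anti₀ (by positivity) (pow_le_pow_right₀ one_le_two hnN)
      calc ((N : ℝ) + 1) * (((2 : ℝ) ^ bnd (i + 1))⁻¹ * 2)
          ≤ 2 ^ N * (((2 : ℝ) ^ N)⁻¹ * ((2 : ℝ) ^ N)⁻¹ * 2) := by gcongr
        _ = 2 * ((2 : ℝ) ^ N)⁻¹ := by
          have : (2 : ℝ) ^ N ≠ 0 := by positivity
          field_simp
        _ ≤ _ := by gcongr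
    have h2 : ‖x - hr.expand i N x‖ ≤ ∑' j, w (j + (N + 1)) := by
      have hs : HasSum (fun j => if j < N + 1 then 0 else w j) (∑' j, w (j + (N + 1))) := by
        rw [← hasSum_nat_add_iff' (N + 1), Finset.sum_eq_zero, sub_zero]
        · have hlt : ∀ n, ¬ n + (N + 1) ≤ N := fun n => by omega
          simpa [hlt] using ((summable_nat_add_iff (N + 1)).2 hws).hasSum
        · intro j hj
          rw [if_pos (Finset.mem_range.1 hj)]
      have hm' := hasSum_map (ContinuousLinearMap.id ℝ L1 - hr.expand i N) x
      have he : (ContinuousLinearMap.id ℝ L1 - hr.expand i N) x = x - hr.expand i N x := rfl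
      rw [← he, ← hm'.tsum_eq]
      refine tsum_of_norm_bounded hs fun j => ?_
      change ‖x j • (unit j - hr.expand i N (unit j))‖ ≤ _
      split_ifs with hj
      · rw [hr.expand_unit_of_le (hNi.trans (bnd_strictMono.monotone (Nat.le_succ i)))
          (by omega), sub_self, smul_zero, norm_zero]
      · have hj' : N < j := by omega
        rcases cases_pos j with ⟨l, p, hp, rfl⟩ | hwk
        · rcases le_or_gt (src l) i with hs | hs
          · have hsn := bnd_strictMono.monotone (src_le_sq (l := l) (n := n) (by omega))
            have hA : 0 < r (src l) ^ (p + 1) := pow_pos (hr.pos _) _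
            rw [hr.expand_unit_known hp hs (by omega), if_neg (by omega), zero_sub,
              sub_neg_eq_add, hr.unit_mid hp, sub_add_cancel, norm_smul, norm_smul,
              Real.norm_eq_abs, Real.norm_eq_abs, abs_of_pos hA]
            have hv := hr.norm_vec_le_two (mid l + p)
            have hx0 := abs_nonneg (x (mid l + p))
            have hAx : r (src l) ^ (p + 1) * |x (mid l + p)| ≤
                D * |x (mid l + p)| + (1 / 2) ^ (mid l + p) := by
              rcases le_or_gt (src l) (m ^ 2) with hsm | hsm
              · have h3 := mul_le_mul_of_nonneg_right (hr.pow_le_ampBound hp hsm) hx0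
                have : (0 : ℝ) < (1 / 2) ^ (mid l + p) := by positivity
                linarith
              · obtain ⟨hml, hl⟩ := lt_of_sq_lt_src hsm
                have hnl : n ≤ Nat.sqrt l := by
                  rw [Nat.le_sqrt']
                  refine Nat.lt_succ_iff.1 (bnd_strictMono.lt_iff_lt.1 (hj'.trans_le ?_))
                  rw [Nat.succ_eq_add_one, bnd_succ]
                  omega
                have hjl : mid l + p ≤ bnd (Nat.sqrt l ^ 2 + (Nat.sqrt l - m)) := by
                  refine le_trans ?_ (bnd_strictMono.monotone (Nat.succ_le_of_lt hl))
                  rw [Nat.succ_eq_add_one, bnd_succ]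
                  omega
                have h3 := (h _ (hn.trans hnl) hml _ hjl).le
                rw [hr.coef_eq_amp_mul (m := m) hp, abs_mul, abs_of_pos hA] at h3
                have h4 : ((2 : ℝ) ^ bnd (Nat.sqrt l ^ 2 + (Nat.sqrt l - m) + 1))⁻¹ ≤
                    (1 / 2) ^ (mid l + p) := by
                  rw [one_div, inv_pow]
                  exact inv_anti₀ (by positivity) (pow_le_pow_right₀ one_le_two
                    (hjl.trans (bnd_strictMono.monotone (Nat.le_succ _))))
                have : 0 ≤ D * |x (mid l + p)| := by positivity
                linarith
            calc |x (mid l + p)| * (r (src l) ^ (p + 1) * ‖vec r (mid l + p)‖)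
                ≤ |x (mid l + p)| * (r (src l) ^ (p + 1) * 2) := by gcongr
              _ = 2 * (r (src l) ^ (p + 1) * |x (mid l + p)|) := by ring
              _ ≤ 2 * (D * |x (mid l + p)| + (1 / 2) ^ (mid l + p)) := by gcongr
              _ = w (mid l + p) := by simp only [hw]; ring
          · rw [hr.expand_unit_new hj' hp hs, sub_zero, norm_smul, norm_unit, mul_one]
            exact hwx _
        · rw [hr.expand_unit_layoff hj' hwk, sub_zero, norm_smul, norm_unit, mul_one]
          exact hwx _
    calc ‖x‖ = ‖hr.expand i N x + (x - hr.expand i N x)‖ := by rw [add_sub_cancel]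
      _ ≤ _ := (norm_add_le _ _).trans (add_le_add h1 h2)
  have hlim : Tendsto (fun n : ℕ => 2 * ((1 : ℝ) / 2) ^ n + ∑' j, w (j + (bnd (n ^ 2) + 1)))
      atTop (𝓝 0) := by
    have h1 : Tendsto (fun n : ℕ => 2 * ((1 : ℝ) / 2) ^ n) atTop (𝓝 0) := by
      simpa using (tendsto_pow_atTop_nhds_zero_of_lt_one (r := (1 : ℝ) / 2) (by norm_num)
        (by norm_num)).const_mul 2
    have h2 : Tendsto (fun n : ℕ => bnd (n ^ 2) + 1) atTop atTop :=
      tendsto_atTop_mono (fun n => ((Nat.le_self_pow two_ne_zero n).trans (le_bnd _)).trans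
        (Nat.le_succ _)) tendsto_id
    simpa using h1.add (htail.comp h2)
  have hx0 : ‖x‖ ≤ 0 := by
    refine ge_of_tendsto hlim ?_
    filter_upwards [eventually_ge_atTop n₀, eventually_ge_atTop m] with n h1 h2
    exact key n h1 h2
  exact norm_le_zero_iff.1 hx0

section Operator

variable {T : L1 →L[ℝ] L1} (hT : ∀ j, T (unit j) = col r j)
include hT

lemma eq_top_of_invariant (hg : Growth r) {J : Submodule ℝ L1} (hJ : IsClosed (J : Set L1))
    (hinv : ∀ x ∈ J, T x ∈ J) (hbot : J ≠ ⊥) : J = ⊤ := by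
  obtain ⟨y, hyJ, hy0⟩ := J.exists_mem_ne_zero_of_ne_bot hbot
  set x := ‖y‖⁻¹ • y with hxdef
  have hxJ : x ∈ J := J.smul_mem _ hyJ
  have hx1 : ‖x‖ = 1 := norm_smul_inv_norm (𝕜 := ℝ) hy0
  have hx0 : x ≠ 0 := fun h => by rw [h, norm_zero] at hx1; exact zero_ne_one hx1
  have hpow : ∀ h : ℕ, (T ^ h) x ∈ J := by
    intro h
    induction h with
    | zero => simpa using hxJ
    | succ h ih => rw [pow_succ', mul_apply_eq_comp]; exact hinv _ ih
  refine hr.cyclic hT hJ hinv ?_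
  rw [← SetLike.mem_coe, ← hJ.closure_eq, Metric.mem_closure_iff]
  intro ε hε
  obtain ⟨m, hm⟩ := hr.exists_inv_le (show 0 < ε / 4 by positivity)
  obtain ⟨n₀, hn₀⟩ := exists_nat_gt (4 / ε)
  have hex : ∃ n, n₀ ≤ n ∧ m ≤ n ∧ ∃ k ≤ bnd (n ^ 2 + (n - m)),
      ((2 : ℝ) ^ bnd (n ^ 2 + (n - m) + 1))⁻¹ ≤ |hr.coef (n ^ 2 + (n - m)) k x| := by
    by_contra! hcon
    exact hx0 (hr.eq_zero_of_coef_small hcon)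
  obtain ⟨n, hn, hmn, hlow⟩ := hex
  obtain ⟨θ, hθ⟩ := hr.exists_polynomial_near hT hg hx1.le hlow
  refine ⟨∑ h ∈ Finset.range (bnd (n ^ 2 + (n - m) + 1) + 1), θ h • (T ^ h) x,
    J.sum_mem fun h _ => J.smul_mem (θ h) (hpow h), ?_⟩
  rw [dist_comm, dist_eq_norm]
  refine hθ.trans_lt ?_
  have h1 : (r (src (n ^ 2 + (n - m))))⁻¹ ≤ ε / 4 := by
    rw [src_sq_add hmn]
    exact (hr.inv_anti (Nat.le_self_pow two_ne_zero m)).trans hm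
  have h2 : 2 / (((n ^ 2 + (n - m) : ℕ) : ℝ) + 1) ≤ ε / 2 := by
    have h3 : (n : ℝ) ≤ ((n ^ 2 + (n - m) : ℕ) : ℝ) := by
      exact_mod_cast (Nat.le_self_pow two_ne_zero n).trans (Nat.le_add_right _ _)
    have h4 : (n₀ : ℝ) ≤ n := by exact_mod_cast hn
    have h5 : 4 < n₀ * ε := (div_lt_iff₀ hε).1 hn₀
    rw [div_le_iff₀ (by positivity)]
    nlinarith
  linarith

end Operator

end Params

end Read

namespace L1

/-- The sum of the coordinates, as a functional. -/
noncomputable def total : L1 →L[ℝ] ℝ := ofCols (fun _ => (1 : ℝ)) 1 (by simp)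

lemma hasSum_total (x : L1) : HasSum (fun i => x i) (total x) := by
  simpa [total, ofCols_unit] using hasSum_map total x

lemma total_le_norm (x : L1) : total x ≤ ‖x‖ :=
  hasSum_le (fun i => le_abs_self (x i)) (hasSum_total x) (hasSum_norm x)

lemma total_eq_norm {x : L1} (hx : ∀ i, 0 ≤ x i) : total x = ‖x‖ :=
  (hasSum_total x).unique (by simpa only [abs_of_nonneg (hx _)] using hasSum_norm x)

/-- The coordinatewise absolute value. -/
noncomputable def modulus (x : L1) : L1 :=
  ⟨fun i => |x i|, memℓp_gen (by simpa using (hasSum_norm x).summable)⟩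

@[simp] lemma modulus_apply (x : L1) (i : ℕ) : modulus x i = |x i| := rfl

lemma norm_modulus (x : L1) : ‖modulus x‖ = ‖x‖ :=
  (hasSum_norm (modulus x)).unique (by simpa using hasSum_norm x)

lemma map_nonneg {A : L1 →L[ℝ] L1} (hA : ∀ i j, 0 ≤ A (unit j) i) {x : L1}
    (hx : ∀ i, 0 ≤ x i) (i : ℕ) : 0 ≤ A x i := by
  have h := (hasSum_map A x).mapL (coord i)
  exact h.nonneg fun j => mul_nonneg (hx j) (hA i j)

lemma pow_map_nonneg {A : L1 →L[ℝ] L1} (hA : ∀ i j, 0 ≤ A (unit j) i) (n : ℕ) {x : L1}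
    (hx : ∀ i, 0 ≤ x i) (i : ℕ) : 0 ≤ (A ^ n) x i := by
  induction n generalizing x with
  | zero => exact hx i
  | succ n ih => exact ih (map_nonneg hA hx)

lemma unit_nonneg (j i : ℕ) : 0 ≤ unit j i := by
  rw [unit_apply]; split_ifs <;> norm_num

lemma exists_lt_sum_norm_pow {A : L1 →L[ℝ] L1} (h : ∀ n, 1 ≤ ‖A ^ n‖) (C : ℝ) :
    ∃ j N, C < ∑ n ∈ Finset.range N, ‖(A ^ n) (unit j)‖ := by
  by_contra! hC
  have hC0 : 0 ≤ C := by simpa using hC 0 0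
  have h1 (n : ℕ) : ‖A ^ n‖ ≤ C := opNorm_le hC0 fun j =>
    (Finset.single_le_sum (f := fun n => ‖(A ^ n) (unit j)‖) (fun _ _ => norm_nonneg _)
      (Finset.self_mem_range_succ n)).trans (hC j (n + 1))
  have h2 (N : ℕ) : (N : ℝ) * ‖A ^ N‖ ≤ C * C := by
    rcases Nat.eq_zero_or_pos N with rfl | hN
    · simpa using mul_nonneg hC0 hC0
    have hN' : (0 : ℝ) < N := Nat.cast_pos.2 hN
    rw [← le_div_iff₀' hN']
    refine opNorm_le (by positivity) fun j => ?_
    rw [le_div_iff₀' hN']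
    calc (N : ℝ) * ‖(A ^ N) (unit j)‖ = ∑ n ∈ Finset.range N, ‖(A ^ N) (unit j)‖ := by simp
      _ ≤ ∑ n ∈ Finset.range N, C * ‖(A ^ n) (unit j)‖ := by
        refine Finset.sum_le_sum fun n hn => ?_
        have : A ^ N = A ^ (N - n) * A ^ n := by
          rw [← pow_add, Nat.sub_add_cancel (Finset.mem_range.1 hn).le]
        rw [this]
        exact ((A ^ (N - n)).le_opNorm _).trans
          (mul_le_mul_of_nonneg_right (h1 _) (norm_nonneg _))
      _ ≤ C * C := by
        rw [← Finset.mul_sum]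
        exact mul_le_mul_of_nonneg_left (hC j N) hC0
  obtain ⟨N, hN⟩ := exists_nat_gt (C * C)
  have := h2 N
  nlinarith [h N, Nat.cast_nonneg (α := ℝ) N]

lemma exists_approximate_eigenvector {A : L1 →L[ℝ] L1} (hA : ∀ i j, 0 ≤ A (unit j) i)
    (h : ∀ n, 1 ≤ ‖A ^ n‖) (hs : ∀ t : ℝ, 0 < t → t < 1 → Summable fun n => t ^ n * ‖A ^ n‖)
    {ε : ℝ} (hε : 0 < ε) : ∃ x : L1, (∀ i, 0 ≤ x i) ∧ ‖x‖ = 1 ∧ ‖A x - x‖ ≤ ε := by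
  set δ := min (ε / (2 * (‖A‖ + 1))) (1 / 2) with hδ
  have hδ0 : 0 < δ := by positivity
  obtain ⟨j, N, hjN⟩ := exists_lt_sum_norm_pow h (2 / ε)
  have hcont : Tendsto (fun t : ℝ => ∑ n ∈ Finset.range N, t ^ n * ‖(A ^ n) (unit j)‖)
      (𝓝[<] 1) (𝓝 (∑ n ∈ Finset.range N, ‖(A ^ n) (unit j)‖)) := by
    have : Continuous fun t : ℝ => ∑ n ∈ Finset.range N, t ^ n * ‖(A ^ n) (unit j)‖ := by
      fun_prop
    simpa using (this.tendsto 1).mono_left nhdsWithin_le_nhds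
  obtain ⟨t, ht1, ht2⟩ := ((hcont.eventually_const_lt hjN).and
    (Ioo_mem_nhdsLT (show 1 - δ < 1 by linarith))).exists
  have ht0 : 0 < t := by
    have := min_le_right (ε / (2 * (‖A‖ + 1))) (1 / 2)
    linarith [ht2.1]
  have hsum : Summable fun n => t ^ n • (A ^ n) (unit j) := by
    refine Summable.of_norm_bounded (hs t ht0 ht2.2) fun n => ?_
    rw [norm_smul, Real.norm_of_nonneg (by positivity)]
    exact mul_le_mul_of_nonneg_left (norm_map_unit_le _ _) (by positivity)
  obtain ⟨y, hy⟩ := hsum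
  have hterm (n i : ℕ) : 0 ≤ (t ^ n • (A ^ n) (unit j)) i :=
    mul_nonneg (by positivity) (pow_map_nonneg hA n (unit_nonneg j) i)
  have hy0 (i : ℕ) : 0 ≤ y i := (hy.mapL (coord i)).nonneg fun n => hterm n i
  have hynorm : 2 / ε < ‖y‖ := by
    refine ht1.trans_le (le_trans ?_ (total_le_norm y))
    refine le_trans (le_of_eq ?_) (sum_le_hasSum (Finset.range N) (fun n _ => ?_)
      (hy.mapL total))
    · refine Finset.sum_congr rfl fun n _ => ?_
      rw [total_eq_norm (hterm n), norm_smul, Real.norm_of_nonneg (by positivity)]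
    · rw [total_eq_norm (hterm n)]
      exact norm_nonneg _
  have hypos : 0 < ‖y‖ := lt_trans (by positivity) hynorm
  have hAy : y = unit j + t • A y := by
    have h1 := (hy.mapL A).const_smul t
    have h2 := (hasSum_nat_add_iff' (f := fun n => t ^ n • (A ^ n) (unit j)) 1).2 hy
    have h3 := h2.unique (a₂ := t • A y) (by
      convert h1 using 2 with n
      rw [map_smul, smul_smul, ← pow_succ', pow_succ' A]
      rfl)
    rw [← h3]
    simp
  refine ⟨‖y‖⁻¹ • y, fun i => mul_nonneg (by positivity) (hy0 i), ?_, ?_⟩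
  · rw [norm_smul, norm_inv, norm_norm, inv_mul_cancel₀ hypos.ne']
  have e1 : A y - y = (1 - t) • A y - unit j := by
    nth_rewrite 2 [hAy]
    module
  rw [map_smul, ← smul_sub, norm_smul, norm_inv, norm_norm, e1, inv_mul_le_iff₀ hypos]
  refine (norm_sub_le _ _).trans ?_
  rw [norm_unit, norm_smul, Real.norm_of_nonneg (by linarith [ht2.2])]
  have e2 : 1 ≤ ‖y‖ * (ε / 2) := by
    rw [div_lt_iff₀ hε] at hynorm; linarith
  have e3 : (1 - t) * (‖A‖ + 1) ≤ ε / 2 := by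
    have : 1 - t ≤ ε / (2 * (‖A‖ + 1)) :=
      (by linarith [ht2.1] : 1 - t ≤ δ).trans (min_le_left _ _)
    rw [le_div_iff₀ (by positivity)] at this
    linarith
  have e4 : (1 - t) * ‖A y‖ ≤ ‖y‖ * (ε / 2) := by
    calc (1 - t) * ‖A y‖ ≤ (1 - t) * ((‖A‖ + 1) * ‖y‖) := by
          refine mul_le_mul_of_nonneg_left ?_ (by linarith [ht2.2])
          exact (A.le_opNorm y).trans (by nlinarith [norm_nonneg y])
      _ = ‖y‖ * ((1 - t) * (‖A‖ + 1)) := by ring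
      _ ≤ _ := mul_le_mul_of_nonneg_left e3 (norm_nonneg _)
  linarith

lemma isCompactOperator_pow_sub {A S : L1 →L[ℝ] L1} (h : IsCompactOperator (A - S)) (N : ℕ) :
    IsCompactOperator (A ^ N - S ^ N : L1 →L[ℝ] L1) := by
  induction N with
  | zero => simpa using isCompactOperator_zero
  | succ N ih =>
    have h1 : (A ^ (N + 1) - S ^ (N + 1) : L1 →L[ℝ] L1) =
        A ^ N * (A - S) + (A ^ N - S ^ N) * S := by
      rw [pow_succ, pow_succ]; noncomm_ring
    rw [h1]
    exact (h.clm_comp (A ^ N)).add (ih.comp_clm S)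

lemma norm_pow_map_sub_le {A : L1 →L[ℝ] L1} (N : ℕ) (x : L1) :
    ‖(A ^ N) x - x‖ ≤ (∑ n ∈ Finset.range N, ‖A ^ n‖) * ‖A x - x‖ := by
  induction N with
  | zero => simp
  | succ N ih =>
    rw [Finset.sum_range_succ, add_mul]
    have : (A ^ (N + 1)) x - x = ((A ^ N) x - x) + (A ^ N) (A x - x) := by
      rw [map_sub, pow_succ]
      change (A ^ N) (A x) - x = _
      abel
    rw [this]
    exact (norm_add_le _ _).trans (add_le_add ih ((A ^ N).le_opNorm _))

/-- A positive operator of spectral radius one on `ℓ¹` whose essential spectral radius is smaller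
than one has a positive fixed vector. -/
theorem exists_nonneg_fixed {A S : L1 →L[ℝ] L1} (hA : ∀ i j, 0 ≤ A (unit j) i)
    (h : ∀ n, 1 ≤ ‖A ^ n‖) (hs : ∀ t : ℝ, 0 < t → t < 1 → Summable fun n => t ^ n * ‖A ^ n‖)
    (hK : IsCompactOperator (A - S)) {N : ℕ} (hS : ‖S ^ N‖ < 1) :
    ∃ x : L1, (∀ i, 0 ≤ x i) ∧ x ≠ 0 ∧ A x = x := by
  choose x hx0 hx1 hx2 using fun k : ℕ =>
    exists_approximate_eigenvector hA h hs (ε := 1 / ((k : ℝ) + 1)) (by positivity)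
  have hlim : Tendsto (fun k => A (x k) - x k) atTop (𝓝 0) :=
    squeeze_zero_norm hx2 tendsto_one_div_add_atTop_nhds_zero_nat
  have hlimN : Tendsto (fun k => x k - (A ^ N) (x k)) atTop (𝓝 0) := by
    refine squeeze_zero_norm (fun k => ?_)
      (by simpa using (hlim.norm.const_mul (∑ n ∈ Finset.range N, ‖A ^ n‖)))
    rw [norm_sub_rev]
    exact norm_pow_map_sub_le N (x k)
  have hcomp := (isCompactOperator_pow_sub hK N).isCompact_closure_image_closedBall
    (f := ((A ^ N - S ^ N : L1 →L[ℝ] L1) : L1 →ₗ[ℝ] L1)) (1 : ℝ)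
  obtain ⟨z, -, φ, hφ, hz⟩ := hcomp.tendsto_subseq (x := fun k => (A ^ N - S ^ N) (x k))
    (fun k => subset_closure ⟨x k, by simp [hx1], rfl⟩)
  let u := Units.oneSub (S ^ N) hS
  have hu : (u : L1 →L[ℝ] L1) = 1 - S ^ N := rfl
  have hz' : Tendsto (fun k => (u : L1 →L[ℝ] L1) (x (φ k))) atTop (𝓝 z) := by
    have := hz.add (hlimN.comp hφ.tendsto_atTop)
    rw [add_zero] at this
    refine this.congr fun k => ?_
    simp [hu]
  have hxlim : Tendsto (fun k => x (φ k)) atTop (𝓝 ((↑u⁻¹ : L1 →L[ℝ] L1) z)) := by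
    refine (((↑u⁻¹ : L1 →L[ℝ] L1).continuous.tendsto z).comp hz').congr fun k => ?_
    change ((↑u⁻¹ : L1 →L[ℝ] L1) * u) (x (φ k)) = _
    rw [Units.inv_mul]; rfl
  refine ⟨(↑u⁻¹ : L1 →L[ℝ] L1) z, fun i => ?_, fun h0 => ?_, ?_⟩
  · exact ge_of_tendsto' (((coord i).continuous.tendsto _).comp hxlim) fun k => hx0 _ i
  · have h1 := hxlim.norm
    simp only [hx1, h0, norm_zero] at h1
    exact one_ne_zero (tendsto_nhds_unique tendsto_const_nhds h1)
  · have h1 := ((A.continuous.tendsto _).comp hxlim).sub hxlim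
    exact sub_eq_zero.1 (tendsto_nhds_unique h1 (hlim.comp hφ.tendsto_atTop))

/-- A positive operator on `ℓ¹` that is a compact perturbation of an operator of spectral radius
zero, and whose own spectral radius is positive, has a positive eigenvector for its spectral
radius. -/
theorem exists_spectral_radius_eigenvector {M S : L1 →L[ℝ] L1} (hM : ∀ i j, 0 ≤ M (unit j) i)
    {c : ℝ} (hc : 0 < c) (hcM : ∀ n, c ^ n ≤ ‖M ^ n‖) (hK : IsCompactOperator (M - S))
    (hS : ∀ ε : ℝ, 0 < ε → ∃ N, ‖S ^ N‖ < ε ^ N) :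
    ∃ r : ℝ, Tendsto (fun n : ℕ => ‖M ^ n‖ ^ (1 / (n : ℝ))) atTop (nhds r) ∧ 0 < r ∧
      ∃ x : L1, (∀ i, 0 ≤ x i) ∧ x ≠ 0 ∧ M x = r • x := by
  have hpos (n : ℕ) : 0 < ‖M ^ n‖ := (pow_pos hc n).trans_le (hcM n)
  have hsub : Subadditive fun n : ℕ => Real.log ‖M ^ n‖ := fun m n => by
    dsimp only
    rw [← Real.log_mul (hpos m).ne' (hpos n).ne', pow_add]
    exact Real.log_le_log (by rw [← pow_add]; exact hpos _) (norm_mul_le _ _)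
  have hbdd : BddBelow (Set.range fun n : ℕ => Real.log ‖M ^ n‖ / n) := by
    refine ⟨min (Real.log c) 0, ?_⟩
    rintro _ ⟨n, rfl⟩
    rcases Nat.eq_zero_or_pos n with rfl | hn
    · simp
    refine (min_le_left _ _).trans ?_
    rw [le_div_iff₀' (Nat.cast_pos.2 hn), ← Real.log_pow]
    exact Real.log_le_log (pow_pos hc n) (hcM n)
  have htend := hsub.tendsto_lim hbdd
  set L := hsub.lim with hL
  have hpow (n : ℕ) (a : ℝ) : Real.exp a ^ n = Real.exp (n * a) := (Real.exp_nat_mul a n).symm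
  have hnorm (n : ℕ) : ‖((Real.exp L)⁻¹ • M) ^ n‖ = (Real.exp L)⁻¹ ^ n * ‖M ^ n‖ := by
    rw [smul_pow, norm_smul, Real.norm_of_nonneg (by positivity)]
  refine ⟨Real.exp L, ?_, Real.exp_pos L, ?_⟩
  · refine ((Real.continuous_exp.tendsto L).comp htend).congr fun n => ?_
    rw [Real.rpow_def_of_pos (hpos n), mul_one_div]
    rfl
  obtain ⟨N, hN⟩ := hS (Real.exp L) (Real.exp_pos L)
  suffices h : ∃ x : L1, (∀ i, 0 ≤ x i) ∧ x ≠ 0 ∧ ((Real.exp L)⁻¹ • M) x = x by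
    obtain ⟨x, hx0, hx1, hx2⟩ := h
    refine ⟨x, hx0, hx1, ?_⟩
    conv_rhs => rw [← hx2]
    change _ = Real.exp L • (Real.exp L)⁻¹ • M x
    rw [smul_inv_smul₀ (Real.exp_pos L).ne']
  refine exists_nonneg_fixed (S := (Real.exp L)⁻¹ • S) (N := N)
    (fun i j => mul_nonneg (by positivity) (hM i j)) (fun n => ?_) (fun t ht0 ht1 => ?_) ?_ ?_
  · rw [hnorm, inv_pow, ← div_eq_inv_mul, one_le_div (by positivity), hpow]
    rcases Nat.eq_zero_or_pos n with rfl | hn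
    · simpa using hcM 0
    · rw [← Real.le_log_iff_exp_le (hpos n), mul_comm, ← le_div_iff₀ (Nat.cast_pos.2 hn)]
      exact hsub.lim_le_div hbdd hn.ne'
  · obtain ⟨s, hs0, hs1⟩ : ∃ s, t < s ∧ s < 1 := exists_between ht1
    have hev : ∀ᶠ n : ℕ in atTop, Real.log ‖M ^ n‖ / n < L + Real.log (s / t) :=
      htend.eventually_lt_const (by
        linarith [Real.log_pos ((one_lt_div ht0).2 hs0)])
    refine Summable.of_norm_bounded_eventually_nat
      (summable_geometric_of_lt_one (ht0.trans hs0).le hs1) ?_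
    filter_upwards [hev, eventually_gt_atTop 0] with n hn hn0
    rw [div_lt_iff₀' (Nat.cast_pos.2 hn0), Real.log_lt_iff_lt_exp (hpos n), ← hpow,
      Real.exp_add, Real.exp_log (div_pos (ht0.trans hs0) ht0)] at hn
    rw [Real.norm_of_nonneg (by positivity), hnorm]
    calc t ^ n * ((Real.exp L)⁻¹ ^ n * ‖M ^ n‖)
        ≤ t ^ n * ((Real.exp L)⁻¹ ^ n * (Real.exp L * (s / t)) ^ n) := by gcongr
      _ = s ^ n := by
        rw [← mul_pow, ← mul_pow]
        congr 1
        field_simp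
  · rw [show (Real.exp L)⁻¹ • M - (Real.exp L)⁻¹ • S = (Real.exp L)⁻¹ • (M - S) by
      rw [smul_sub]]
    exact hK.smul (Real.exp L)⁻¹
  · rw [smul_pow, norm_smul, Real.norm_of_nonneg (by positivity), inv_pow, ← div_eq_inv_mul,
      div_lt_one (by positivity)]
    exact hN

/-- The projection onto the first `n` coordinates. -/
noncomputable def trunc (n : ℕ) : L1 →L[ℝ] L1 :=
  ∑ i ∈ Finset.range n, (coord i).smulRight (unit i)

lemma trunc_apply (n : ℕ) (x : L1) (i : ℕ) : trunc n x i = if i < n then x i else 0 := by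
  have : trunc n x = ∑ k ∈ Finset.range n, x k • unit k := by simp [trunc]
  have h2 := congrArg (coord i) this
  simp only [map_sum, map_smul, coord_apply, unit_apply, smul_eq_mul, mul_ite, mul_one,
    mul_zero, Finset.sum_ite_eq, Finset.mem_range] at h2
  exact h2

lemma isCompactOperator_trunc (n : ℕ) : IsCompactOperator (trunc n) := by
  unfold trunc
  induction n with
  | zero => simpa using isCompactOperator_zero
  | succ n ih =>
    rw [Finset.sum_range_succ]
    refine ih.add ?_
    have h : IsCompactOperator (coord n)  :=
      isCompactOperator_of_locallyCompactSpace_dom (coord n)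
    exact h.clm_comp (ContinuousLinearMap.toSpanSingleton ℝ (unit n))

lemma norm_sub_trunc_le {n : ℕ} {x a : L1} (ha : ∀ i, n ≤ i → a i = 0) :
    ‖x - trunc n x‖ ≤ ‖x - a‖ := by
  refine hasSum_le (fun i => ?_) (hasSum_norm _) (hasSum_norm _)
  change |x i - trunc n x i| ≤ |x i - a i|
  rw [trunc_apply]
  split_ifs with h
  · simp
  · rw [ha i (by omega)]

/-- A bounded operator on `ℓ¹` with uniformly small column tails is compact. -/
lemma isCompactOperator_of_tails {U : L1 →L[ℝ] L1}
    (h : ∀ ε : ℝ, 0 < ε → ∃ n, ∀ j, ‖U (unit j) - trunc n (U (unit j))‖ ≤ ε) :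
    IsCompactOperator U := by
  refine (isClosed_setOfPred_isCompactOperator (𝕜₁ := ℝ) (σ₁₂ := RingHom.id ℝ)
    (M₁ := L1) (M₂ := L1)).closure_subset (Metric.mem_closure_iff.2 fun ε hε => ?_)
  obtain ⟨n, hn⟩ := h (ε / 2) (half_pos hε)
  refine ⟨trunc n * U, (isCompactOperator_trunc n).comp_clm U, ?_⟩
  rw [dist_eq_norm]
  exact (opNorm_le (half_pos hε).le hn).trans_lt (half_lt_self hε)

end L1

namespace L1

lemma norm_modulus_sub_le (x y : L1) : ‖modulus x - modulus y‖ ≤ ‖x - y‖ :=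
  hasSum_le (fun i => abs_abs_sub_abs_le (x i) (y i)) (hasSum_norm _) (hasSum_norm _)

lemma modulus_smul_unit {c : ℝ} (hc : 0 ≤ c) (j : ℕ) : modulus (c • unit j) = c • unit j := by
  ext i
  exact abs_of_nonneg (mul_nonneg hc (unit_nonneg j i))

lemma pow_le_norm_pow {A : L1 →L[ℝ] L1} (hA : ∀ i j, 0 ≤ A (unit j) i) {d : ℝ} (hd : 0 ≤ d)
    {k : ℕ} (h : d ^ 2 ≤ (A * A) (unit k) k) (n : ℕ) : d ^ n ≤ ‖A ^ n‖ := by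
  have hB : ∀ i j, 0 ≤ (A * A) (unit j) i := fun i j => map_nonneg hA (fun i => hA i j) i
  have h1 : (d ^ 2) ^ n ≤ ((A * A) ^ n) (unit k) k := by
    induction n with
    | zero => simp
    | succ n ih =>
      have h2 := (hasSum_map ((A * A) ^ n) ((A * A) (unit k))).mapL (coord k)
      have h3 := le_hasSum h2 k fun j _ =>
        mul_nonneg (hB j k) (pow_map_nonneg hB n (unit_nonneg j) k)
      rw [pow_succ, mul_comm, pow_succ]
      exact (mul_le_mul h ih (by positivity) (hB k k)).trans h3
  refine (sq_le_sq₀ (by positivity) (norm_nonneg _)).1 ?_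
  calc (d ^ n) ^ 2 = (d ^ 2) ^ n := by rw [← pow_mul, ← pow_mul, mul_comm]
    _ ≤ ((A * A) ^ n) (unit k) k := h1
    _ ≤ ‖((A * A) ^ n) (unit k)‖ := (le_abs_self _).trans (abs_apply_le _ _)
    _ ≤ ‖(A * A) ^ n‖ := norm_map_unit_le _ _
    _ ≤ ‖A ^ n‖ ^ 2 := by
      rw [← pow_two A, ← pow_mul, mul_comm, pow_mul, pow_two, pow_two]
      exact norm_mul_le _ _

end L1

namespace Read

open L1

/-- The positions strictly inside a copied region. -/
def Inner (j : ℕ) : Prop := ∃ l p, p < bnd (src l) ∧ j = mid l + p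

lemma inner_or_end {j : ℕ} (h : ¬ Inner j) :
    ¬ Working j ∨ ∃ l, j = mid l + bnd (src l) := by
  rcases cases_pos j with ⟨l, p, hp, rfl⟩ | hw
  · rcases hp.lt_or_eq with hp | rfl
    · exact absurd ⟨l, p, hp, rfl⟩ h
    · exact Or.inr ⟨l, rfl⟩
  · exact Or.inl hw

lemma mid_strictMono : StrictMono mid := fun a b h => by
  have := bnd_strictMono h
  unfold mid
  omega

section Support

variable (r : ℕ → ℝ)

lemma vec_apply_eq_zero {j i : ℕ} (h : j < i) : vec r j i = 0 := by
  induction j using Nat.strong_induction_on with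
  | _ j ih =>
    rcases cases_pos j with ⟨l, p, hp, rfl⟩ | hw
    · have hm : 0 < mid l := by unfold mid; omega
      have h1 := ih p (by omega) (by omega)
      have h2 : unit (mid l + p) i = 0 := by rw [unit_apply, if_neg (by omega)]
      rw [vec_mid r hp]
      change _ * unit (mid l + p) i + vec r p i = 0
      rw [h1, h2, mul_zero, add_zero]
    · rw [vec_layoff r hw, unit_apply, if_neg (by omega)]

lemma col_apply_eq_zero {j i : ℕ} (hj : ¬ Inner j) (h : j + 1 < i) : col r j i = 0 := by
  rcases inner_or_end hj with hw | ⟨l, rfl⟩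
  · rw [col_layoff r hw]
    change _ * vec r (j + 1) i = 0
    rw [vec_apply_eq_zero r h, mul_zero]
  · rw [← bnd_succ] at h
    have := bnd_src_le l
    have := bnd_strictMono (show l < l + 1 by omega)
    rw [col_end]
    change _ * vec r (bnd (l + 1) + 1) i - _ * vec r (bnd (src l) + 1) i = 0
    rw [vec_apply_eq_zero r h, vec_apply_eq_zero r (by omega), mul_zero, mul_zero, sub_zero]

end Support

namespace Params

variable {r : ℕ → ℝ} (hr : Params r)
include hr

lemma pow_mul_eta_succ_le {s l : ℕ} (hs : s ≤ l) :
    r s ^ (bnd s + 1) * eta r (l + 1) ≤ (r l)⁻¹ := by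
  have h1 : r s ^ (bnd s + 1) ≤ r l ^ (bnd l + 1) :=
    (pow_le_pow_left₀ (hr.pos s).le (hr.mono hs) _).trans (pow_le_pow_right₀ (hr.one_le l)
      (Nat.succ_le_succ (bnd_strictMono.monotone hs)))
  calc r s ^ (bnd s + 1) * eta r (l + 1) ≤ r l ^ (bnd l + 1) * eta r l :=
        mul_le_mul h1 (hr.eta_anti (Nat.le_succ l)) (hr.eta_pos _).le
          (pow_nonneg (hr.pos l).le _)
    _ ≤ ((r l)⁻¹) ^ 2 := hr.pow_mul_eta_le le_rfl le_rfl
    _ ≤ (r l)⁻¹ := pow_le_of_le_one (hr.inv_nonneg l) (hr.inv_le_one l) two_ne_zero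

/-- The columns outside the interior of copied regions have uniformly small tails. -/
lemma exists_col_near {ε : ℝ} (hε : 0 < ε) : ∃ n, ∀ j, ¬ Inner j →
    ∃ a : L1, (∀ i, n ≤ i → a i = 0) ∧ ‖col r j - a‖ ≤ ε := by
  obtain ⟨I, hI⟩ := hr.exists_inv_le (ε := ε / 4) (by positivity)
  have hsmall {l : ℕ} (hl : I ≤ l) : (r l)⁻¹ ≤ ε / 4 := (hr.inv_anti hl).trans hI
  refine ⟨mid I + 2, fun j hj => ?_⟩
  rcases le_or_gt j (mid I) with hjI | hjI
  · exact ⟨col r j, fun i hi => col_apply_eq_zero r hj (by omega), by simpa using hε.le⟩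
  rcases inner_or_end hj with hw | ⟨l, rfl⟩
  · refine ⟨0, fun i _ => rfl, ?_⟩
    obtain ⟨l, hl1, hl2⟩ := (cases_wt j).resolve_right hj
    have hl : I ≤ l := (mid_strictMono.lt_iff_lt.1 (hjI.trans hl2)).le
    rw [sub_zero]
    have h1 := hr.norm_col_layoff_le hw
    rw [wt_layoff r hl1 hl2] at h1
    linarith [hr.eta_le_inv l, hsmall hl]
  · have hl : I ≤ l := by
      by_contra! h
      have h1 := bnd_strictMono.monotone (Nat.succ_le_of_lt h)
      have h2 := bnd_lt_mid I
      rw [← bnd_succ] at hjI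
      simp only [Nat.succ_eq_add_one] at h1
      omega
    rcases le_or_gt I (src l) with hs | hs
    · refine ⟨0, fun i _ => rfl, ?_⟩
      rw [sub_zero]
      have h1 := hr.norm_col_end_le l
      have h2 : ((r (src l))⁻¹) ^ 2 ≤ (r (src l))⁻¹ :=
        pow_le_of_le_one (hr.inv_nonneg _) (hr.inv_le_one _) two_ne_zero
      linarith [hsmall hs]
    · refine ⟨-((r (src l) ^ (bnd (src l) + 1) * eta r (src l)) • vec r (bnd (src l) + 1)),
        fun i hi => ?_, ?_⟩
      · have h1 := bnd_strictMono hs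
        have h2 := bnd_lt_mid I
        change -(_ * vec r (bnd (src l) + 1) i) = 0
        rw [vec_apply_eq_zero r (by omega), mul_zero, neg_zero]
      · rw [col_end, sub_neg_eq_add, sub_add_cancel, norm_smul,
          Real.norm_of_nonneg (mul_nonneg (pow_nonneg (hr.pos _).le _) (hr.eta_pos _).le)]
        have h1 := hr.pow_mul_eta_succ_le (src_le l)
        have h2 := mul_le_mul (h1.trans (hsmall hl)) (hr.norm_vec_le_two (bnd (l + 1) + 1))
          (norm_nonneg _) (by positivity)
        linarith

section InnerPart

variable {S : L1 →L[ℝ] L1} (hSi : ∀ j, Inner j → S (unit j) = col r j)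
  (hSo : ∀ j, ¬ Inner j → S (unit j) = 0)
include hSi hSo

lemma pow_map_unit_mid {l : ℕ} (h : ℕ) : ∀ {p : ℕ}, p ≤ bnd (src l) →
    ‖(S ^ h) (unit (mid l + p))‖ ≤ ((r (src l))⁻¹) ^ h ∧
      (bnd (src l) < p + h → (S ^ h) (unit (mid l + p)) = 0) := by
  induction h with
  | zero => exact fun {p} hp => ⟨by simp, fun h => absurd h (by omega)⟩
  | succ h ih =>
    intro p hp
    have h0 := hr.inv_nonneg (src l)
    rw [pow_succ, mul_apply_eq_comp]
    rcases hp.lt_or_eq with hp' | rfl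
    · obtain ⟨h1, h2⟩ := ih (show p + 1 ≤ _ from hp')
      rw [hSi _ ⟨l, p, hp', rfl⟩, hr.col_inner hp', map_smul, add_assoc]
      refine ⟨?_, fun h3 => ?_⟩
      · rw [norm_smul, Real.norm_of_nonneg (mul_nonneg (hr.wt_pos p).le h0), pow_succ,
          mul_comm (_ ^ h)]
        exact mul_le_mul (mul_le_of_le_one_left h0 (hr.wt_le_one p)) h1 (norm_nonneg _) h0
      · rw [h2 (by omega), smul_zero]
    · have : ¬ Inner (mid l + bnd (src l)) := by
        rintro ⟨l', p', hp', he⟩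
        have h1 := blk_mid (le_refl (bnd (src l)))
        rw [he, blk_mid hp'.le] at h1
        subst h1
        omega
      rw [hSo _ this, map_zero, norm_zero]
      exact ⟨by positivity, fun _ => rfl⟩

lemma exists_norm_pow_inner_lt {ε : ℝ} (hε : 0 < ε) : ∃ N, ‖S ^ N‖ < ε ^ N := by
  obtain ⟨I, hI⟩ := hr.exists_inv_le (half_pos hε)
  refine ⟨bnd I + 1, lt_of_le_of_lt (opNorm_le (C := (ε / 2) ^ (bnd I + 1)) (by positivity)
    fun j => ?_) (pow_lt_pow_left₀ (half_lt_self hε) (by positivity) (Nat.succ_ne_zero _))⟩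
  rcases cases_pos j with ⟨l, p, hp, rfl⟩ | hw
  · obtain ⟨h1, h2⟩ := hr.pow_map_unit_mid hSi hSo (bnd I + 1) hp
    rcases le_or_gt I (src l) with hs | hs
    · exact h1.trans (pow_le_pow_left₀ (hr.inv_nonneg _) ((hr.inv_anti hs).trans hI) _)
    · have := bnd_strictMono hs
      rw [h2 (by omega), norm_zero]
      positivity
  · have : ¬ Inner j := fun ⟨l, p, hp, he⟩ => hw (he ▸ working_mid hp.le)
    rw [pow_succ, mul_apply_eq_comp, hSo j this, map_zero, norm_zero]
    positivity

end InnerPart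

section Modulus

variable {M : L1 →L[ℝ] L1} (hM : ∀ j, M (unit j) = modulus (col r j))
include hM

lemma eta_sq_le_modulus_sq : eta r 0 ^ 2 ≤ (M * M) (unit 0) 0 := by
  have hm : mid 0 = 2 := by simp [mid, bnd_zero]
  have hw1 : ¬ Working 1 := by
    rw [working_iff]
    rintro ⟨l, p, -, h⟩
    have := mid_strictMono.monotone (Nat.zero_le l)
    omega
  have hs : src 0 = 0 := Nat.le_zero.1 (src_le 0)
  have hwt (j : ℕ) (hj : j < 2) : wt r j = eta r 0 :=
    wt_layoff r (by rw [bnd_zero]; omega) (by omega)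
  have h0 : M (unit 0) = eta r 0 • unit 1 := by
    rw [hM, col_layoff r not_working_zero, zero_add, vec_layoff r hw1, hwt 0 (by omega),
      modulus_smul_unit (hr.eta_pos 0).le]
  have h2 : vec r 2 0 = 1 := by
    have := vec_mid r (l := 0) (p := 0) (Nat.zero_le _)
    rw [hm, vec_zero] at this
    rw [this]
    change _ * unit 2 0 + unit 0 0 = 1
    simp
  have h1 : M (unit 1) 0 = eta r 0 := by
    rw [hM, col_layoff r hw1, hwt 1 (by omega)]
    change |_ * vec r 2 0| = _
    rw [h2, mul_one, abs_of_pos (hr.eta_pos 0)]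
  rw [mul_apply_eq_comp, h0, map_smul]
  change _ ≤ _ * M (unit 1) 0
  rw [h1, pow_two]

lemma exists_positive_eigenvector :
    ∃ ρ : ℝ, Tendsto (fun n : ℕ => ‖M ^ n‖ ^ (1 / (n : ℝ))) atTop (nhds ρ) ∧ 0 < ρ ∧
      ∃ x : L1, (∀ i, 0 ≤ x i) ∧ x ≠ 0 ∧ M x = ρ • x := by
  classical
  have hpos : ∀ i j, 0 ≤ M (unit j) i := fun i j => by
    rw [hM, modulus_apply]; exact abs_nonneg _
  obtain ⟨S, hS⟩ := exists_cols (fun j => if Inner j then col r j else 0) 2 fun j => by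
    split_ifs
    · exact hr.norm_col_le j
    · simp
  have hSi (j : ℕ) (h : Inner j) : S (unit j) = col r j := by rw [hS, if_pos h]
  have hSo (j : ℕ) (h : ¬ Inner j) : S (unit j) = 0 := by rw [hS, if_neg h]
  refine exists_spectral_radius_eigenvector hpos (hr.eta_pos 0)
    (pow_le_norm_pow hpos (hr.eta_pos 0).le (hr.eta_sq_le_modulus_sq hM))
    (isCompactOperator_of_tails fun ε hε => ?_)
    (fun ε hε => hr.exists_norm_pow_inner_lt hSi hSo hε)
  obtain ⟨n, hn⟩ := hr.exists_col_near hε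
  refine ⟨n, fun j => ?_⟩
  by_cases hj : Inner j
  · have : (M - S) (unit j) = 0 := by
      obtain ⟨l, p, hp, rfl⟩ := hj
      rw [sub_apply, hM, hSi _ ⟨l, p, hp, rfl⟩, hr.col_inner hp,
        modulus_smul_unit (mul_nonneg (hr.wt_pos p).le (hr.inv_nonneg _)), sub_self]
    rw [this, map_zero, sub_zero, norm_zero]
    exact hε.le
  · obtain ⟨a, ha, hle⟩ := hn j hj
    rw [sub_apply, hM, hSo j hj, sub_zero]
    refine (norm_sub_trunc_le (a := modulus a) fun i hi => ?_).trans
      ((norm_modulus_sub_le _ _).trans hle)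
    rw [modulus_apply, ha i hi, abs_zero]

end Modulus

end Params

end Read

lemma L1.span_singleton_ne_top (x : L1) : Submodule.span ℝ {x} ≠ ⊤ := by
  intro h
  have h0 : L1.unit 0 ∈ Submodule.span ℝ {x} := h ▸ Submodule.mem_top
  have h1 : L1.unit 1 ∈ Submodule.span ℝ {x} := h ▸ Submodule.mem_top
  obtain ⟨a, ha⟩ := Submodule.mem_span_singleton.1 h0
  obtain ⟨b, hb⟩ := Submodule.mem_span_singleton.1 h1
  have e (i : ℕ) : a * x i = L1.unit 0 i := by rw [← ha]; rfl
  have f (i : ℕ) : b * x i = L1.unit 1 i := by rw [← hb]; rfl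
  have e0 := e 0
  have f0 := f 0
  have f1 := f 1
  simp only [L1.unit_apply] at e0 f0 f1
  norm_num at e0 f0 f1
  rcases f0 with rfl | h
  · simp at f1
  · simp [h] at e0

/-- There exists a quasinilpotent bounded operator `T` on `ℓ¹` with no nontrivial
closed invariant subspace whose modulus `|T|` has strictly positive spectral radius
`r(|T|)` and a positive eigenvector for the eigenvalue `r(|T|)`; in particular `|T|`
has a nontrivial closed invariant subspace even though `T` has none. -/
theorem exists_no_invariant_subspace_but_modulus_has_positive_eigenvector :
    ∃ T : lp (fun _ : ℕ => ℝ) 1 →L[ℝ] lp (fun _ : ℕ => ℝ) 1,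
      -- `T` is quasinilpotent
      Tendsto (fun n : ℕ => ‖T ^ n‖ ^ (1 / (n : ℝ))) atTop (nhds 0) ∧
      -- `T` has no nontrivial closed invariant subspace
      (¬ ∃ J : Submodule ℝ (lp (fun _ : ℕ => ℝ) 1),
        IsClosed (J : Set (lp (fun _ : ℕ => ℝ) 1)) ∧ J ≠ ⊥ ∧ J ≠ ⊤ ∧
        ∀ x ∈ J, T x ∈ J) ∧
      -- the modulus `|T|` has spectral radius `r > 0` which is an eigenvalue with a
      -- positive eigenvector, hence `|T|` has a nontrivial closed invariant subspace
      (∃ M : lp (fun _ : ℕ => ℝ) 1 →L[ℝ] lp (fun _ : ℕ => ℝ) 1,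
        (∀ i j : ℕ, M (lp.single 1 j 1) i = |T (lp.single 1 j 1) i|) ∧
        (∃ r : ℝ, Tendsto (fun n : ℕ => ‖M ^ n‖ ^ (1 / (n : ℝ))) atTop (nhds r) ∧
          0 < r ∧
          ∃ x : lp (fun _ : ℕ => ℝ) 1, (∀ i, 0 ≤ x i) ∧ x ≠ 0 ∧ M x = r • x) ∧
        (∃ J : Submodule ℝ (lp (fun _ : ℕ => ℝ) 1),
          IsClosed (J : Set (lp (fun _ : ℕ => ℝ) 1)) ∧ J ≠ ⊥ ∧ J ≠ ⊤ ∧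
          ∀ x ∈ J, M x ∈ J)) := by
  obtain ⟨r, hr, hg⟩ := Read.exists_params
  obtain ⟨T, hT⟩ := L1.exists_cols (Read.col r) 2 hr.norm_col_le
  obtain ⟨M, hM⟩ := L1.exists_cols (fun j => L1.modulus (Read.col r j)) 2 fun j => by
    rw [L1.norm_modulus]; exact hr.norm_col_le j
  obtain ⟨ρ, hρ, hρ0, x, hx0, hxne, hx⟩ := hr.exists_positive_eigenvector hM
  refine ⟨T, hr.quasinilpotent hT, ?_, M, fun i j => ?_, ⟨ρ, hρ, hρ0, x, hx0, hxne, hx⟩,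
    Submodule.span ℝ {x}, Submodule.closed_of_finiteDimensional _, ?_,
    L1.span_singleton_ne_top x, fun y hy => ?_⟩
  · rintro ⟨J, hJ, hbot, htop, hinv⟩
    exact htop (hr.eq_top_of_invariant hT hg hJ hinv hbot)
  · exact (congrArg (fun v : L1 => v i) (hM j)).trans
      (congrArg (fun v : L1 => |v i|) (hT j)).symm
  · rwa [Ne, Submodule.span_singleton_eq_bot]
  · obtain ⟨a, rfl⟩ := Submodule.mem_span_singleton.1 hy
    rw [map_smul, hx]
    exact Submodule.smul_mem _ _ (Submodule.smul_mem _ _ (Submodule.mem_span_singleton_self x))
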